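/- There exist C > 0 and N such that for all n ≥ N: |E_{ν_n⊗ν_n}[CV_{AB}²] − (11/12600)·n²| ≤ C·n, where the expectation is over two independent random balanced dice A, B with faces in [−√3, √3], each distributed according to ν_n. In particular, for all large n, √(E[CV_{AB}²]) > 0.025·n. -/

import Mathlib

open MeasureTheory ProbabilityTheory Set
open scoped ENNReal NNReal

noncomputable def extendDie (n : ℕ) (s : ℝ) (a : Fin (n - 1) → ℝ) : Fin n → ℝ :=
  fun i => if h : (i : ℕ) < n - 1 then a ⟨i, h⟩ else s - ∑ j, a j

noncomputable def diceMeasure (n : ℕ) (lo hi s : ℝ) : Measure (Fin n → ℝ) :=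
  Measure.map (extendDie n s)
    (ProbabilityTheory.cond volume
      {a : Fin (n - 1) → ℝ | (∀ i, a i ∈ Set.Icc lo hi) ∧ (s - ∑ i, a i) ∈ Set.Icc lo hi})

/-- `g_A(x) = |{i : a_i ≤ x}| - n·(x+√3)/(2√3)` for a die with faces in `[-√3,√3]`. -/
noncomputable def gDie (n : ℕ) (A : Fin n → ℝ) (x : ℝ) : ℝ :=
  ((Finset.univ.filter fun i => A i ≤ x).card : ℝ) -
    n * ((x + Real.sqrt 3) / (2 * Real.sqrt 3))

/-- Expectation with respect to `V` uniform on `[-√3,√3]`. -/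
noncomputable def meanS (f : ℝ → ℝ) : ℝ :=
  (2 * Real.sqrt 3)⁻¹ * ∫ x in Set.Icc (-Real.sqrt 3) (Real.sqrt 3), f x

/-- `CV_{AB} = Cov(g_A(V), g_B(V))`. -/
noncomputable def cvDie₂ (n : ℕ) (A B : Fin n → ℝ) : ℝ :=
  meanS (fun x => gDie n A x * gDie n B x) - meanS (gDie n A) * meanS (gDie n B)

namespace DiceAux

lemma cos_upper (x : ℝ) : Real.cos x ≤ 1 - x^2/2 + x^4/24 := by
  wlog hx : 0 ≤ x
  · have := this (-x) (by linarith)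
    rw [Real.cos_neg] at this
    calc _ ≤ _ := this
      _ = _ := by ring
  have hm : MonotoneOn (fun x : ℝ => 1 - x^2/2 + x^4/24 - Real.cos x) (Ici 0) := by
    apply monotoneOn_of_deriv_nonneg (convex_Ici 0)
    · fun_prop
    · fun_prop
    · intro y hy
      have hy' : 0 < y := by simpa using hy
      have h : HasDerivAt (fun x : ℝ => 1 - x^2/2 + x^4/24 - Real.cos x)
          (0 - (2 * y^1)/2 + (4*y^3)/24 - (-Real.sin y)) y := by
        refine HasDerivAt.sub (HasDerivAt.add (HasDerivAt.sub (hasDerivAt_const _ _)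
          ((by simpa using hasDerivAt_pow 2 y : HasDerivAt (fun x : ℝ => x^2) (2*y^1) y).div_const 2)) ((by simpa using hasDerivAt_pow 4 y : HasDerivAt (fun x : ℝ => x^4) (4*y^3) y).div_const 24)) (Real.hasDerivAt_cos y)
      rw [h.deriv]
      have := Real.sin_ge_sub_cube hy'.le
      linarith
  have := hm (by simp) (by simpa using hx) hx
  simp at this
  linarith

lemma sin_upper {x : ℝ} (hx : 0 ≤ x) : Real.sin x ≤ x - x^3/6 + x^5/120 := by
  have hm : MonotoneOn (fun x : ℝ => x - x^3/6 + x^5/120 - Real.sin x) (Ici 0) := by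
    apply monotoneOn_of_deriv_nonneg (convex_Ici 0)
    · fun_prop
    · fun_prop
    · intro y hy
      have h : HasDerivAt (fun x : ℝ => x - x^3/6 + x^5/120 - Real.sin x)
          (1 - (3 * y^2)/6 + (5*y^4)/120 - (Real.cos y)) y := by
        refine HasDerivAt.sub (HasDerivAt.add (HasDerivAt.sub (hasDerivAt_id _)
          ((by simpa using hasDerivAt_pow 3 y : HasDerivAt (fun x : ℝ => x^3) (3*y^2) y).div_const 6)) ((by simpa using hasDerivAt_pow 5 y : HasDerivAt (fun x : ℝ => x^5) (5*y^4) y).div_const 120)) (Real.hasDerivAt_sin y)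
      rw [h.deriv]
      have := cos_upper y
      linarith
  have := hm (by simp) (by simpa using hx) hx
  simp at this
  linarith

lemma sinc_lower (t : ℝ) : 1 - t^2/6 ≤ Real.sinc t := by
  wlog ht : 0 ≤ t
  · have := this (-t) (by linarith)
    simpa using this
  rcases ht.eq_or_lt with rfl | h
  · simp
  rw [Real.sinc_of_ne_zero h.ne', le_div_iff₀ h]
  have := Real.sin_ge_sub_cube ht
  linarith [this, (by ring : (1 - t^2/6)*t = t - t^3/6)]

lemma sinc_upper (t : ℝ) : Real.sinc t ≤ 1 - t^2/6 + t^4/120 := by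
  wlog ht : 0 ≤ t
  · have := this (-t) (by linarith)
    rw [Real.sinc_neg] at this
    calc _ ≤ _ := this
      _ = _ := by ring
  rcases ht.eq_or_lt with rfl | h
  · simp
  rw [Real.sinc_of_ne_zero h.ne', div_le_iff₀ h]
  have := sin_upper ht
  linarith [this, (by ring : (1 - t^2/6 + t^4/120)*t = t - t^3/6 + t^5/120)]

lemma mul_sinc (t : ℝ) : t * Real.sinc t = Real.sin t := by
  by_cases h : t = 0
  · simp [h]
  · rw [Real.sinc_of_ne_zero h]; field_simp

lemma sinc_nonneg {t : ℝ} (h : |t| ≤ 3) : 0 ≤ Real.sinc t := by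
  wlog ht : 0 ≤ t
  · have := @this (-t) (by simpa using h) (by linarith)
    simpa using this
  rcases ht.eq_or_lt with rfl | h'
  · simp
  rw [Real.sinc_of_ne_zero h'.ne']
  rw [abs_of_nonneg ht] at h
  exact div_nonneg (Real.sin_nonneg_of_nonneg_of_le_pi ht (by linarith [Real.pi_gt_three])) ht

lemma sinc_sq_le (t : ℝ) : (Real.sinc t)^2 ≤ (1 + t^2/15)⁻¹ := by
  rw [← one_div, le_div_iff₀ (by positivity)]
  rcases le_or_gt (|t|) 3 with h | h
  · have h0 := sinc_nonneg h
    have h1 := sinc_upper t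
    have h2 := Real.sinc_le_one t
    have ht2 : t^2 ≤ 9 := by
      rw [← sq_abs]; nlinarith [abs_nonneg t]
    have h3 : Real.sinc t ≤ 1 - t^2/15 := by nlinarith [sq_nonneg t]
    have h4 : (Real.sinc t)^2 ≤ 1 - t^2/15 := by nlinarith
    nlinarith [sq_nonneg t]
  · have ht2 : 9 ≤ t^2 := by
      rw [← sq_abs]; nlinarith [abs_nonneg t]
    have h1 := mul_sinc t
    have h2 : t^2 * (Real.sinc t)^2 ≤ 1 := by
      rw [← mul_pow, h1]; exact Real.sin_sq_le_one t
    have : (Real.sinc t)^2 * 9 ≤ 1 := by nlinarith [sq_nonneg (Real.sinc t)]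
    nlinarith [sq_nonneg (Real.sinc t)]

lemma sinc_pow_le {m : ℕ} (hm : 8 ≤ m) (t : ℝ) :
    |Real.sinc t|^m ≤ ((1 + m * t^2/240)^4)⁻¹ := by
  obtain ⟨r, hr1, hr2⟩ : ∃ r : ℕ, 8 * r ≤ m ∧ m ≤ 16 * r := ⟨m/8, by omega, by omega⟩
  have hs := Real.abs_sinc_le_one t
  calc |Real.sinc t|^m ≤ |Real.sinc t|^(8*r) := pow_le_pow_of_le_one (abs_nonneg _) hs hr1
    _ = (((Real.sinc t)^2)^r)^4 := by
      rw [← sq_abs, ← pow_mul, ← pow_mul]; congr 1; ring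
    _ ≤ (((1 + t^2/15)⁻¹)^r)^4 := by
      gcongr; exact sinc_sq_le t
    _ = (((1+t^2/15)^r)^4)⁻¹ := by rw [inv_pow, inv_pow]
    _ ≤ ((1 + m * t^2/240)^4)⁻¹ := by
      gcongr
      have := one_add_mul_le_pow (a := t^2/15) (by have := sq_nonneg t; linarith) r
      refine le_trans ?_ this
      have h : (m:ℝ) ≤ 16 * r := by exact_mod_cast hr2
      nlinarith [sq_nonneg t]

lemma integrable_sinc_pow {m : ℕ} (hm : 2 ≤ m) : Integrable (fun t => Real.sinc t ^ m) := by
  have h0 : Integrable (fun t : ℝ => 15 * (1 + t^2)⁻¹) := integrable_inv_one_add_sq.const_mul 15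
  refine h0.mono' (by fun_prop) (Filter.Eventually.of_forall fun t => ?_)
  rw [Real.norm_eq_abs, abs_pow]
  calc |Real.sinc t|^m ≤ |Real.sinc t|^2 := pow_le_pow_of_le_one (abs_nonneg _) (Real.abs_sinc_le_one t) hm
    _ ≤ (1 + t^2/15)⁻¹ := by rw [sq_abs]; exact sinc_sq_le t
    _ ≤ ((1 + t^2)/15)⁻¹ := by
      gcongr; linarith
    _ = _ := by rw [inv_div]; rfl

/-- base kernel -/
noncomputable def hk (k : ℕ) (u : ℝ) : ℝ := |u|^k * ((1 + u^2/240)^4)⁻¹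

lemma hk_cont (k : ℕ) : Continuous (hk k) := by
  unfold hk
  refine Continuous.mul (by fun_prop) (Continuous.inv₀ (by fun_prop) fun u => by positivity)

lemma hk_int {k : ℕ} (hk6 : k ≤ 6) : Integrable (hk k) := by
  have h0 : Integrable (fun t : ℝ => 240^4 * (1 + t^2)⁻¹) := integrable_inv_one_add_sq.const_mul _
  refine h0.mono' (hk_cont k).aestronglyMeasurable (Filter.Eventually.of_forall fun u => ?_)
  have h1 : |u|^k ≤ (1+u^2)^3 := by
    rcases le_total (|u|) 1 with h | h
    · exact (pow_le_one₀ (abs_nonneg _) h).trans (one_le_pow₀ (by nlinarith))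
    · calc |u|^k ≤ |u|^6 := pow_le_pow_right₀ h hk6
        _ = (u^2)^3 := by rw [← sq_abs u]; ring
        _ ≤ _ := by gcongr; linarith
  have h2 : 0 ≤ hk k u := by unfold hk; positivity
  rw [Real.norm_eq_abs, abs_of_nonneg h2]
  unfold hk
  calc |u|^k * ((1 + u^2/240)^4)⁻¹ ≤ (1+u^2)^3 * (((1+u^2)/240)^4)⁻¹ := by
        gcongr; linarith
    _ = _ := by
      field_simp

lemma absmom {k : ℕ} (hk6 : k ≤ 6) : ∃ C > (0:ℝ), ∀ m : ℕ, 8 ≤ m →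
    Integrable (fun t => |t|^k * |Real.sinc t|^m) ∧
    ∫ t, |t|^k * |Real.sinc t|^m ≤ C / (Real.sqrt m)^(k+1) := by
  refine ⟨(∫ u, hk k u) + 1, ?_, fun m hm => ?_⟩
  · have : 0 ≤ ∫ u, hk k u := integral_nonneg fun u => by
      change 0 ≤ hk k u
      unfold hk; positivity
    linarith
  have hm0 : (0:ℝ) < m := by exact_mod_cast (by omega : 0 < m)
  set r := Real.sqrt m with hr
  have hr0 : 0 < r := Real.sqrt_pos.2 hm0
  have hr2 : r^2 = m := Real.sq_sqrt hm0.le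
  have hb : ∀ t, |t|^k * |Real.sinc t|^m ≤ (r^k)⁻¹ * hk k (r * t) := by
    intro t
    unfold hk
    rw [abs_mul, abs_of_pos hr0, mul_pow, mul_pow, hr2]
    calc |t|^k * |Real.sinc t|^m ≤ |t|^k * ((1 + m * t^2/240)^4)⁻¹ := by
          gcongr; exact sinc_pow_le hm t
      _ = _ := by field_simp
  have hi : Integrable (fun t => (r^k)⁻¹ * hk k (r * t)) :=
    ((hk_int hk6).comp_mul_left' hr0.ne').const_mul _
  have hI : Integrable (fun t => |t|^k * |Real.sinc t|^m) := by
    refine hi.mono' (by fun_prop) (Filter.Eventually.of_forall fun t => ?_)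
    rw [Real.norm_eq_abs, abs_of_nonneg (by positivity)]
    exact hb t
  refine ⟨hI, (integral_mono hI hi hb).trans ?_⟩
  rw [integral_const_mul, Measure.integral_comp_mul_left, abs_of_pos (by positivity)]
  rw [smul_eq_mul, div_eq_mul_inv, pow_succ, mul_inv]
  have : 0 < (r^k)⁻¹ * r⁻¹ := by positivity
  nlinarith

end DiceAux

namespace DiceAux

noncomputable def J (m : ℕ) (s : ℝ) : ℝ := ∫ t, Real.sinc t ^ m * Real.cos (t * s)
noncomputable def M2 (m : ℕ) : ℝ := ∫ t, t^2 * Real.sinc t ^ m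
noncomputable def Ab (k m : ℕ) : ℝ := ∫ t, |t|^k * |Real.sinc t| ^ m

lemma Ab_int {k m : ℕ} (hk : k ≤ 6) (hm : 8 ≤ m) : Integrable (fun t => |t|^k * |Real.sinc t|^m) := by
  obtain ⟨C, _, h⟩ := absmom hk
  exact (h m hm).1

lemma Ab_nonneg (k m : ℕ) : 0 ≤ Ab k m := integral_nonneg fun t => by positivity

lemma J_zero (m : ℕ) : J m 0 = ∫ t, Real.sinc t ^ m := by simp [J]

lemma J_int {m : ℕ} (hm : 2 ≤ m) (s : ℝ) : Integrable (fun t => Real.sinc t ^ m * Real.cos (t * s)) := by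
  refine (integrable_sinc_pow hm).norm.mono' (by fun_prop) (Filter.Eventually.of_forall fun t => ?_)
  rw [norm_mul]
  exact mul_le_of_le_one_right (norm_nonneg _) (Real.abs_cos_le_one _)

lemma M2_int {m : ℕ} (hm : 8 ≤ m) : Integrable (fun t => t^2 * Real.sinc t ^ m) := by
  refine (Ab_int (by norm_num : 2 ≤ 6) hm).mono' (by fun_prop) (Filter.Eventually.of_forall fun t => ?_)
  rw [norm_mul, norm_pow, norm_pow]; rfl

lemma M2_abs {m : ℕ} : |M2 m| ≤ Ab 2 m := by
  unfold M2 Ab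
  rw [← Real.norm_eq_abs]
  refine (norm_integral_le_integral_norm _).trans (le_of_eq ?_)
  congr 1; ext t
  rw [norm_mul, norm_pow, norm_pow]; rfl

lemma int_bound {k m : ℕ} (hk : k ≤ 6) (hm : 8 ≤ m) (f : ℝ → ℝ)
    (h : ∀ t, |f t| ≤ |t|^k * |Real.sinc t|^m) : |∫ t, f t| ≤ Ab k m := by
  rw [← Real.norm_eq_abs]
  exact norm_integral_le_of_norm_le (Ab_int hk hm) (Filter.Eventually.of_forall h)

lemma one_sub_cos_abs (x : ℝ) : |Real.cos x - 1| ≤ x^2/2 := by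
  have h1 := Real.one_sub_sq_div_two_le_cos (x := x)
  have h2 := Real.cos_le_one x
  rw [abs_le]; constructor <;> linarith [sq_nonneg x]

lemma one_sub_sinc_abs (x : ℝ) : |Real.sinc x - 1| ≤ x^2/6 := by
  have h1 := sinc_lower x
  have h2 := Real.sinc_le_one x
  rw [abs_le]; constructor <;> linarith [sq_nonneg x]

lemma J_sub1 {m : ℕ} (hm : 8 ≤ m) {s : ℝ} (hs : |s| ≤ 1) : |J m s - J (m+1) 0| ≤ Ab 2 m := by
  rw [J_zero]
  unfold J
  rw [← integral_sub (J_int (by omega) s) (integrable_sinc_pow (by omega))]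
  apply int_bound (by norm_num) hm
  intro t
  rw [pow_succ, ← mul_sub, abs_mul, abs_pow, mul_comm]
  gcongr
  have h1 := abs_le.1 (one_sub_cos_abs (t*s))
  have h2 := abs_le.1 (one_sub_sinc_abs t)
  have h3 : (t*s)^2 ≤ t^2 := by
    rw [mul_pow]
    have : s^2 ≤ 1 := by rw [← sq_abs]; nlinarith [abs_nonneg s]
    nlinarith [sq_nonneg t]
  rw [abs_le, sq_abs]
  constructor <;> nlinarith [sq_nonneg t]

lemma J_sub2 {m : ℕ} (hm : 8 ≤ m) : |J m 0 - J (m+2) 0| ≤ Ab 2 m := by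
  rw [J_zero, J_zero]
  rw [← integral_sub (integrable_sinc_pow (by omega)) (integrable_sinc_pow (by omega))]
  apply int_bound (by norm_num) hm
  intro t
  rw [pow_add, ← mul_one_sub, abs_mul, abs_pow, mul_comm]
  gcongr
  have h2 := abs_le.1 (one_sub_sinc_abs t)
  have h3 := Real.abs_sinc_le_one t
  have h4 : Real.sinc t ^ 2 ≤ 1 := by rw [← sq_abs]; nlinarith [abs_nonneg (Real.sinc t)]
  rw [abs_of_nonneg (by linarith), sq_abs]
  nlinarith [abs_le.1 h3]

lemma J_taylor {m : ℕ} (hm : 8 ≤ m) {s : ℝ} (hs : |s| ≤ 2) :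
    |J m s - (J m 0 - M2 m * s^2 / 2)| ≤ Ab 4 m := by
  have e : J m s - (J m 0 - M2 m * s^2 / 2) =
      ∫ t, (Real.sinc t ^ m * Real.cos (t*s) - (Real.sinc t ^ m - t^2 * Real.sinc t ^ m * (s^2/2))) := by
    rw [integral_sub (J_int (by omega) s), integral_sub (integrable_sinc_pow (by omega)), integral_mul_const, J_zero]
    · unfold J M2; ring
    · exact (M2_int hm).mul_const _
    · exact (integrable_sinc_pow (by omega)).sub ((M2_int hm).mul_const _)
  rw [e]
  apply int_bound (by norm_num) hm
  intro t
  have e2 : Real.sinc t ^ m * Real.cos (t*s) - (Real.sinc t ^ m - t^2 * Real.sinc t ^ m * (s^2/2))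
    = (Real.cos (t*s) - (1 - (t*s)^2/2)) * Real.sinc t ^ m := by ring
  rw [e2, abs_mul, abs_pow]
  gcongr
  have h1 := Real.one_sub_sq_div_two_le_cos (x := t*s)
  have h2 := cos_upper (t*s)
  rw [abs_of_nonneg (by linarith)]
  have h3 : s^4 ≤ 16 := by
    have : s^2 ≤ 4 := by rw [← sq_abs]; nlinarith [abs_nonneg s]
    nlinarith [sq_nonneg s]
  have h4 : |t|^4 = t^4 := by rw [← abs_pow]; exact abs_of_nonneg (by positivity)
  rw [h4]
  have : (t*s)^4 ≤ 16 * t^4 := by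
    rw [mul_pow]; nlinarith [mul_le_mul_of_nonneg_left h3 (by positivity : 0 ≤ t^4)]
  nlinarith [(by positivity : 0 ≤ t^4)]

lemma sinc_diff : Differentiable ℝ Real.sinc := by
  intro t
  by_cases h : t = 0
  · subst h
    have h1 : (fun x => Real.sinc x - 1) =O[nhds 0] fun x => ‖x - 0‖^2 := by
      refine Asymptotics.IsBigO.of_bound 1 (Filter.Eventually.of_forall fun x => ?_)
      have := one_sub_sinc_abs x
      simp only [sub_zero, norm_pow, one_mul, Real.norm_eq_abs, sq_abs]
      nlinarith [sq_nonneg x]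
    have h2 := (h1.hasFDerivAt (𝕜 := ℝ) (by norm_num)).differentiableAt
    have := h2.add_const 1
    simpa using this
  · have : Real.sinc =ᶠ[nhds t] fun x => Real.sin x / x := by
      filter_upwards [isOpen_ne.mem_nhds h] with x hx
      exact Real.sinc_of_ne_zero hx
    rw [this.differentiableAt_iff]
    exact Real.differentiableAt_sin.div differentiableAt_id h

lemma mul_deriv_sinc (t : ℝ) : t * deriv Real.sinc t = Real.cos t - Real.sinc t := by
  have h1 : HasDerivAt (fun t => t * Real.sinc t) (1 * Real.sinc t + t * deriv Real.sinc t) t :=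
    (hasDerivAt_id t).mul (sinc_diff t).hasDerivAt
  have h2 : (fun t => t * Real.sinc t) = Real.sin := funext mul_sinc
  rw [h2] at h1
  have := h1.unique (Real.hasDerivAt_sin t)
  linarith

lemma cos_sinc_abs (t : ℝ) : |Real.cos t - Real.sinc t| ≤ t^2 := by
  have h1 := abs_le.1 (one_sub_cos_abs t)
  have h2 := abs_le.1 (one_sub_sinc_abs t)
  rw [abs_le]
  constructor <;> nlinarith [sq_nonneg t]

lemma cs_int {m : ℕ} (hm : 8 ≤ m) : Integrable (fun t => Real.sinc t ^ m * (Real.cos t - Real.sinc t)) := by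
  refine (Ab_int (by norm_num : 2 ≤ 6) hm).mono' (by fun_prop) (Filter.Eventually.of_forall fun t => ?_)
  rw [norm_mul, norm_pow, mul_comm]
  simp only [Real.norm_eq_abs]
  gcongr
  rw [sq_abs]; exact cos_sinc_abs t

lemma ibp {m : ℕ} (hm : 8 ≤ m) :
    J (m+1) 0 + (m+1) * ∫ t, Real.sinc t ^ m * (Real.cos t - Real.sinc t) = 0 := by
  have hd : ∀ t, HasDerivAt (fun t => t * Real.sinc t ^ (m+1))
      (Real.sinc t ^ (m+1) + (m+1) * (Real.sinc t ^ m * (Real.cos t - Real.sinc t))) t := by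
    intro t
    have : HasDerivAt (fun t => t * Real.sinc t ^ (m+1)) _ t :=
      (hasDerivAt_id t).mul ((sinc_diff t).hasDerivAt.pow (m+1))
    refine this.congr_deriv ?_
    rw [← mul_deriv_sinc]
    simp
    ring
  have i1 : Integrable (fun t => Real.sinc t ^ (m+1)) := integrable_sinc_pow (by omega)
  have i2 := (cs_int hm).const_mul ((m:ℝ)+1)
  have := integral_eq_zero_of_hasDerivAt_of_integrable hd (i1.add i2) ?_
  · rw [integral_add i1 i2, integral_const_mul] at this
    rw [J_zero]; exact this
  · refine (Ab_int (by norm_num : 1 ≤ 6) (by omega : 8 ≤ m+1)).mono' (by fun_prop) (Filter.Eventually.of_forall fun t => ?_)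
    rw [norm_mul, norm_pow, pow_one]; rfl

lemma M2_J {m : ℕ} (hm : 8 ≤ m) :
    |((m:ℝ)+1) * M2 (m+1) / 3 - J (m+1) 0| ≤ ((m:ℝ)+1) * Ab 4 m := by
  have h := ibp hm
  have e : (∫ t, Real.sinc t ^ m * (Real.cos t - Real.sinc t)) + M2 (m+1) / 3 =
     ∫ t, (Real.sinc t ^ m * (Real.cos t - Real.sinc t) + t^2 * Real.sinc t ^ (m+1) / 3) := by
    rw [integral_add (cs_int hm) ((M2_int (by omega)).div_const 3), integral_div]; rfl
  have b : |∫ t, (Real.sinc t ^ m * (Real.cos t - Real.sinc t) + t^2 * Real.sinc t ^ (m+1) / 3)| ≤ Ab 4 m := by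
    apply int_bound (by norm_num) hm
    intro t
    have e2 : Real.sinc t ^ m * (Real.cos t - Real.sinc t) + t^2 * Real.sinc t ^ (m+1) / 3
      = (Real.cos t - Real.sinc t + t^2 / 3 * Real.sinc t) * Real.sinc t ^ m := by ring
    rw [e2, abs_mul, abs_pow]
    gcongr
    have h4 : |t|^4 = t^4 := by rw [← abs_pow]; exact abs_of_nonneg (by positivity)
    rw [h4]
    have h1 := Real.one_sub_sq_div_two_le_cos (x := t)
    have h2 := cos_upper t
    have h3 := sinc_lower t
    have h5 := sinc_upper t
    have h6 := Real.sinc_le_one t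
    rw [abs_le]
    constructor <;> nlinarith [sq_nonneg t, (by positivity : 0 ≤ t^4), mul_nonneg (sq_nonneg t) (sub_nonneg.2 h6), mul_nonneg (sq_nonneg t) (sub_nonneg.2 h3)]
  rw [← e] at b
  have hm1 : (0:ℝ) < (m:ℝ)+1 := by positivity
  have : ((m:ℝ)+1) * M2 (m+1) / 3 - J (m+1) 0 = ((m:ℝ)+1) * ((∫ t, Real.sinc t ^ m * (Real.cos t - Real.sinc t)) + M2 (m+1) / 3) := by
    linarith
  rw [this, abs_mul, abs_of_pos hm1]
  gcongr

lemma J_lower {n : ℕ} (hn : 8 ≤ n) : 1 / Real.sqrt n - Ab 4 n ≤ J n 0 := by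
  have hn0 : (0:ℝ) < n := by exact_mod_cast (by omega : 0 < n)
  set r := Real.sqrt n
  have hr0 : 0 < r := Real.sqrt_pos.2 hn0
  have hr2 : r^2 = n := Real.sq_sqrt hn0.le
  have i1 : Integrable (indicator (Icc (-(1/r)) (1/r)) (fun _ : ℝ => (1/2:ℝ))) := by
    rw [integrable_indicator_iff measurableSet_Icc]
    exact integrableOn_const (by simp)
  have i2 := Ab_int (by norm_num : 4 ≤ 6) hn
  have e : 1 / r - Ab 4 n = ∫ t, (indicator (Icc (-(1/r)) (1/r)) (fun _ : ℝ => (1/2:ℝ)) t - |t|^4 * |Real.sinc t|^n) := by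
    rw [integral_sub i1 i2, integral_indicator measurableSet_Icc]
    simp only [integral_const, smul_eq_mul]
    unfold Ab
    congr 1
    simp
    rw [max_eq_left (by positivity)]
    ring
  rw [e, J_zero]
  refine integral_mono (i1.sub i2) (integrable_sinc_pow (by omega)) fun t => ?_
  simp only [indicator, mem_Icc]
  have hA : -|Real.sinc t|^n ≤ Real.sinc t ^ n := by rw [← abs_pow]; exact neg_abs_le _
  have hB : 0 ≤ |t|^4 * |Real.sinc t|^n := by positivity
  split_ifs with h
  · have ht : t^2 ≤ 1/n := by
      rw [← hr2, ← one_div_pow]; exact sq_le_sq' h.1 h.2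
    have h1 := sinc_lower t
    have h2 : 1 + (n:ℝ) * (-(1/(6*n))) ≤ (1 + -(1/(6*n)))^n := one_add_mul_le_pow (by
      have : 1/(6*(n:ℝ)) ≤ 1 := by
        rw [div_le_one (by positivity)]
        have : (8:ℝ) ≤ n := by exact_mod_cast hn
        linarith
      linarith) n
    have h3 : (1 + -(1/(6*(n:ℝ))))^n ≤ Real.sinc t ^ n := by
      apply pow_le_pow_left₀
      · have : 1/(6*(n:ℝ)) ≤ 1 := by
          rw [div_le_one (by positivity)]
          have : (8:ℝ) ≤ n := by exact_mod_cast hn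
          linarith
        linarith
      · have : 1/(6*(n:ℝ)) = 1/n/6 := by field_simp
        linarith
    have h4 : (n:ℝ) * (-(1/(6*n))) = -1/6 := by field_simp
    linarith
  · rcases le_total (|t|) 3 with h3 | h3
    · have := pow_nonneg (sinc_nonneg h3) n
      linarith
    · have : (1:ℝ) ≤ |t|^4 := one_le_pow₀ (by linarith)
      nlinarith [pow_nonneg (abs_nonneg (Real.sinc t)) n]

lemma Ab_bounds : ∃ C > (0:ℝ), ∃ N : ℕ, ∀ n : ℕ, N ≤ n → 0 < J n 0 ∧
    ∀ m : ℕ, n ≤ m + 3 → Ab 2 m ≤ C / n * J n 0 ∧ Ab 4 m ≤ C / n^2 * J n 0 := by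
  obtain ⟨C2, hC2, h2⟩ := absmom (by norm_num : 2 ≤ 6)
  obtain ⟨C4, hC4, h4⟩ := absmom (by norm_num : 4 ≤ 6)
  obtain ⟨N0, hN0⟩ := exists_nat_gt (2 * C4)
  refine ⟨16 * C2 + 64 * C4, by positivity, N0 + 16, fun n hn => ?_⟩
  have hn16 : (16:ℝ) ≤ n := by exact_mod_cast (by omega : 16 ≤ n)
  have hnN : 2 * C4 < n := hN0.trans_le (by exact_mod_cast (by omega : N0 ≤ n))
  have hn0 : (0:ℝ) < n := by linarith
  set r := Real.sqrt n with hr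
  have hr0 : 0 < r := Real.sqrt_pos.2 hn0
  have hr2 : r^2 = n := Real.sq_sqrt hn0.le
  have hJ : 1 / (2 * r) ≤ J n 0 := by
    have l := J_lower (n := n) (by omega)
    have b : Ab 4 n ≤ C4 / r^5 := (h4 n (by omega)).2
    have : C4 / r^5 ≤ 1/(2*r) := by
      rw [div_le_div_iff₀ (by positivity) (by positivity)]
      have : r^5 = r * n^2 := by rw [← hr2]; ring
      rw [this]
      have : 2 * C4 ≤ n^2 := by nlinarith
      nlinarith
    have e : 1/r = 1/(2*r) + 1/(2*r) := by field_simp; norm_num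
    rw [← hr] at l
    linarith
  have hJ0 : 0 < J n 0 := lt_of_lt_of_le (by positivity) hJ
  refine ⟨hJ0, fun m hm => ?_⟩
  have hm' : (n:ℝ) ≤ 4 * m := by exact_mod_cast (by omega : n ≤ 4 * m)
  have hrm : r/2 ≤ Real.sqrt m := by
    apply Real.le_sqrt_of_sq_le
    rw [div_pow, hr2]; linarith
  constructor
  · calc Ab 2 m ≤ C2 / (Real.sqrt m)^3 := (h2 m (by omega)).2
      _ ≤ C2 / (r/2)^3 := by gcongr
      _ = (16 * C2) / n * (1 / (2*r)) := by rw [← hr2]; field_simp; norm_num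
      _ ≤ (16 * C2 + 64 * C4) / n * J n 0 := by
        gcongr; linarith
  · calc Ab 4 m ≤ C4 / (Real.sqrt m)^5 := (h4 m (by omega)).2
      _ ≤ C4 / (r/2)^5 := by gcongr
      _ = (64 * C4) / n^2 * (1 / (2*r)) := by rw [← hr2]; field_simp; norm_num
      _ ≤ (16 * C2 + 64 * C4) / n^2 * J n 0 := by
        gcongr; linarith

lemma J_ratio : ∃ C > (0:ℝ), ∃ N : ℕ, ∀ n : ℕ, N ≤ n → 0 < J n 0 ∧
    (∀ s, |s| ≤ 1 → |J (n-1) s / J n 0 - 1| ≤ C / n) ∧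
    ∃ α β : ℝ, (∀ s, |s| ≤ 2 → |J (n-2) s / J n 0 - (α - β * s^2)| ≤ C / n^2) ∧
      |2 * β * n - 3| ≤ C / n := by
  obtain ⟨C, hC, N, h⟩ := Ab_bounds
  refine ⟨20 * C, by positivity, N + 16, fun n hn => ?_⟩
  obtain ⟨hJ, hA⟩ := h n (by omega)
  obtain ⟨m, rfl⟩ : ∃ m, n = m + 3 := ⟨n - 3, by omega⟩
  have hm : 8 ≤ m := by omega
  have hn0 : (0:ℝ) < ((m+3 : ℕ):ℝ) := by positivity
  set n := m + 3 with hn'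
  have hn3 : n - 1 = m + 2 := by omega
  have hn2 : n - 2 = m + 1 := by omega
  rw [hn3, hn2]
  refine ⟨hJ, fun s hs => ?_, J (m+1) 0 / J n 0, M2 (m+1) / (2 * J n 0), fun s hs => ?_, ?_⟩
  · have e : J (m+2) s / J n 0 - 1 = (J (m+2) s - J n 0) / J n 0 := by field_simp
    rw [e, abs_div, abs_of_pos hJ, div_le_iff₀ hJ]
    refine (J_sub1 (by omega) hs).trans ((hA (m+2) (by omega)).1.trans ?_)
    gcongr; linarith
  · have e : J (m+1) s / J n 0 - (J (m+1) 0 / J n 0 - M2 (m+1) / (2 * J n 0) * s^2)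
        = (J (m+1) s - (J (m+1) 0 - M2 (m+1) * s^2/2)) / J n 0 := by field_simp
    rw [e, abs_div, abs_of_pos hJ, div_le_iff₀ hJ]
    refine (J_taylor (by omega) hs).trans ((hA (m+1) (by omega)).2.trans ?_)
    gcongr; linarith
  · have e : 2 * (M2 (m+1) / (2 * J n 0)) * n - 3 = (n * M2 (m+1) - 3 * J n 0) / J n 0 := by field_simp
    rw [e, abs_div, abs_of_pos hJ, div_le_iff₀ hJ]
    have b1 := M2_J hm
    have b2 : |J (m+1) 0 - J n 0| ≤ Ab 2 (m+1) := J_sub2 (by omega)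
    have b3 := M2_abs (m := m+1)
    have c1 := (hA (m+1) (by omega)).1
    have c2 := (hA m (by omega)).2
    have c3 : ((m:ℝ)+1) * Ab 4 m ≤ C / n * J n 0 := by
      calc ((m:ℝ)+1) * Ab 4 m ≤ n * (C / n^2 * J n 0) := by
            have : ((m:ℝ)+1) ≤ n := by rw [hn']; push_cast; linarith
            have := Ab_nonneg 4 m
            gcongr
        _ = _ := by field_simp
    have en : (n:ℝ) = m + 3 := by rw [hn']; push_cast; ring
    have e2 : (n * M2 (m+1) - 3 * J n 0) = 3 * (((m:ℝ)+1) * M2 (m+1) / 3 - J (m+1) 0) + 3 * (J (m+1) 0 - J n 0) + 2 * M2 (m+1) := by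
      rw [en]; ring
    have e3 : 20 * C / n * J n 0 = 20 * (C / n * J n 0) := by ring
    have pos : 0 ≤ C / n * J n 0 := by positivity
    rw [e2, e3]
    rw [abs_le] at *
    constructor <;> linarith [b1.1, b1.2, b2.1, b2.2, b3.1, b3.2]

end DiceAux

namespace DiceAux

/-- convolution on the line -/
noncomputable def cv (F G : ℝ → ℝ) (s : ℝ) : ℝ := ∫ x, F x * G (s - x)

structure Good (F : ℝ → ℝ) : Prop where
  meas : Measurable F
  bdd : ∃ B : ℝ, 0 ≤ B ∧ ∀ x, |F x| ≤ B
  supp : ∃ c : ℝ, ∀ x, c < |x| → F x = 0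

lemma Good.integrable {F : ℝ → ℝ} (h : Good F) : Integrable F := by
  obtain ⟨B, hB0, hB⟩ := h.bdd
  obtain ⟨c, hc⟩ := h.supp
  have h1 : IntegrableOn F (Icc (-c) c) :=
    Measure.integrableOn_of_bounded (M := B) (by simp) h.meas.aestronglyMeasurable
      (Filter.Eventually.of_forall hB)
  refine (integrableOn_iff_integrable_of_support_subset ?_).1 h1
  intro x hx
  by_contra hx'
  apply hx
  apply hc
  by_contra h2
  exact hx' (abs_le.1 (not_lt.1 h2))

lemma Good.triple {F G H : ℝ → ℝ} (hF : Good F) (hG : Good G) (hH : Good H) (s : ℝ) :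
    Integrable (fun p : ℝ × ℝ => F p.1 * G p.2 * H (s - p.1 - p.2)) (volume.prod volume) := by
  obtain ⟨B, hB0, hB⟩ := hH.bdd
  refine (hF.integrable.mul_prod hG.integrable).mul_bdd ?_ (Filter.Eventually.of_forall fun p => (Real.norm_eq_abs _).trans_le (hB _))
  exact (hH.meas.comp (by fun_prop)).aestronglyMeasurable

lemma Good.mulcomp {F G : ℝ → ℝ} (hF : Good F) (hG : Good G) (s : ℝ) :
    Integrable (fun x : ℝ => F x * G (s - x)) := by
  obtain ⟨B, hB0, hB⟩ := hG.bdd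
  refine hF.integrable.mul_bdd ?_ (Filter.Eventually.of_forall fun p => (Real.norm_eq_abs _).trans_le (hB _))
  exact (hG.meas.comp (by fun_prop)).aestronglyMeasurable

lemma Good.cv {F G : ℝ → ℝ} (hF : Good F) (hG : Good G) : Good (cv F G) := by
  obtain ⟨B, hB0, hB⟩ := hG.bdd
  obtain ⟨c, hc⟩ := hF.supp
  obtain ⟨d, hd⟩ := hG.supp
  refine ⟨?_, ⟨∫ x, |F x| * B, ?_, fun s => ?_⟩, ⟨c + d, fun s hs => ?_⟩⟩
  · unfold DiceAux.cv
    refine StronglyMeasurable.measurable ?_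
    refine StronglyMeasurable.integral_prod_right (f := fun s x => F x * G (s - x)) ?_
    refine Measurable.stronglyMeasurable ?_
    exact (hF.meas.comp measurable_snd).mul (hG.meas.comp (measurable_fst.sub measurable_snd))
  · exact integral_nonneg fun x => by positivity
  · rw [← Real.norm_eq_abs]
    refine norm_integral_le_of_norm_le (hF.integrable.abs.mul_const B) (Filter.Eventually.of_forall fun x => ?_)
    rw [norm_mul, Real.norm_eq_abs, Real.norm_eq_abs]
    gcongr
    exact hB _
  · unfold DiceAux.cv
    have : (fun x => F x * G (s - x)) = fun _ => 0 := by
      ext x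
      by_cases h1 : c < |x|
      · rw [hc x h1, zero_mul]
      · rw [hd, mul_zero]
        have := abs_sub_abs_le_abs_sub s x
        linarith
    rw [this]; simp

lemma cv_comm (F G : ℝ → ℝ) : cv F G = cv G F := by
  ext s
  unfold cv
  rw [← integral_sub_left_eq_self _ _ s]
  congr 1; ext x
  rw [sub_sub_cancel, mul_comm]

lemma cv_cv_apply (F G H : ℝ → ℝ) (s : ℝ) :
    cv F (cv G H) s = ∫ x, ∫ y, F x * G y * H (s - x - y) := by
  unfold cv
  congr 1; ext x
  rw [← integral_const_mul]
  congr 1; ext y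
  ring

lemma cv_left_comm {F G H : ℝ → ℝ} (hF : Good F) (hG : Good G) (hH : Good H) :
    cv F (cv G H) = cv G (cv F H) := by
  ext s
  rw [cv_cv_apply, cv_cv_apply, integral_integral_swap (hF.triple hG hH s)]
  congr 1; ext y; congr 1; ext x
  rw [mul_comm (F x)]; congr 2; ring

noncomputable def cl : List (ℝ → ℝ) → ℝ → ℝ
  | [] => 0
  | [F] => F
  | F :: G :: l => cv F (cl (G :: l))

lemma cl_cons (F : ℝ → ℝ) {l : List (ℝ → ℝ)} (hl : l ≠ []) : cl (F :: l) = cv F (cl l) := by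
  cases l with
  | nil => exact absurd rfl hl
  | cons G l => rfl

lemma cl_good : ∀ l : List (ℝ → ℝ), (∀ F ∈ l, Good F) → Good (cl l)
  | [], _ => ⟨measurable_const, ⟨0, le_rfl, fun x => by simp [cl]⟩, ⟨0, fun x _ => rfl⟩⟩
  | [F], h => h F (by simp)
  | F :: G :: l, h => (h F (by simp)).cv (cl_good (G :: l) fun H hH => h H (List.mem_cons_of_mem _ hH))

lemma cl_perm {l₁ l₂ : List (ℝ → ℝ)} (h : l₁.Perm l₂) (hg : ∀ F ∈ l₁, Good F) : cl l₁ = cl l₂ := by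
  induction h with
  | nil => rfl
  | @cons F l₁ l₂ h ih =>
    have ih' := ih fun H hH => hg H (List.mem_cons_of_mem _ hH)
    by_cases hl : l₁ = []
    · subst hl
      rw [h.nil_eq]
    · have hl2 : l₂ ≠ [] := fun h2 => by subst h2; exact hl h.eq_nil
      rw [cl_cons F hl, cl_cons F hl2, ih']
  | swap F G l =>
    cases l with
    | nil => exact cv_comm _ _
    | cons H l =>
      change cv G (cv F (cl (H :: l))) = cv F (cv G (cl (H :: l)))
      exact cv_left_comm (hg G (by simp)) (hg F (by simp)) (cl_good _ fun K hK => hg K (by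
        exact List.mem_cons_of_mem _ (List.mem_cons_of_mem _ hK)))
  | trans h1 h2 ih1 ih2 =>
    rw [ih1 hg, ih2 fun F hF => hg F (h1.mem_iff.2 hF)]

lemma pi_integrable {m : ℕ} (F : Fin (m+1) → ℝ → ℝ) (hF : ∀ i, Good (F i)) (s : ℝ) :
    Integrable (fun a : Fin m → ℝ => (∏ i : Fin m, F i.castSucc (a i)) * F (Fin.last m) (s - ∑ i, a i)) := by
  obtain ⟨B, hB0, hB⟩ := (hF (Fin.last m)).bdd
  have h1 : Integrable (fun a : Fin m → ℝ => (∏ i : Fin m, F i.castSucc (a i))) :=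
    Integrable.fintype_prod (f := fun i : Fin m => F i.castSucc) fun i => (hF _).integrable
  refine h1.mul_bdd ?_ (Filter.Eventually.of_forall fun p => (Real.norm_eq_abs _).trans_le (hB _))
  exact ((hF (Fin.last m)).meas.comp (by fun_prop)).aestronglyMeasurable

lemma pi_integral : ∀ {m : ℕ} (F : Fin (m+1) → ℝ → ℝ) (_ : ∀ i, Good (F i)) (s : ℝ),
    ∫ a : Fin m → ℝ, (∏ i : Fin m, F i.castSucc (a i)) * F (Fin.last m) (s - ∑ i, a i)
      = cl (List.ofFn F) s := by
  intro m
  induction m with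
  | zero =>
    intro F hF s
    simp [cl, measureReal_def, volume_pi]
  | succ m ih =>
    intro F hF s
    have hmp := (volume_preserving_piFinSuccAbove (fun _ : Fin (m+1) => ℝ) 0).symm
    rw [← hmp.integral_comp', List.ofFn_succ, cl_cons _ (by simp), Measure.volume_eq_prod, integral_prod]
    · unfold cv
      congr 1; ext x
      rw [← ih _ (fun i => hF _), ← integral_const_mul]
      congr 1; ext a
      simp only [MeasurableEquiv.piFinSuccAbove_symm_apply, Fin.insertNthEquiv_zero, Fin.consEquiv_apply]
      rw [Fin.prod_univ_succ, Fin.sum_univ_succ]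
      simp only [Fin.cons_zero, Fin.cons_succ, Fin.castSucc_zero, Fin.succ_last, mul_assoc, sub_sub]
      rfl
    · exact hmp.integrable_comp_of_integrable (pi_integrable F hF s)

noncomputable def q (c : ℝ) : ℝ → ℝ := indicator (Icc (-c) c) (fun _ => 1)

lemma q_good (c : ℝ) : Good (q c) := by
  refine ⟨measurable_const.indicator measurableSet_Icc, ⟨1, by norm_num, fun x => ?_⟩, ⟨c, fun x hx => ?_⟩⟩
  · unfold q indicator; split_ifs <;> simp
  · unfold q; rw [indicator_of_notMem]
    rintro ⟨h1, h2⟩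
    exact absurd (abs_le.2 ⟨h1, h2⟩) (not_le.2 hx)

lemma cv_qq (c s : ℝ) : cv (q c) (q c) s = max (min c (s + c) - max (-c) (s - c)) 0 := by
  unfold cv
  have : (fun x => q c x * q c (s - x)) = indicator (Icc (max (-c) (s-c)) (min c (s+c))) (fun _ => 1) := by
    ext x
    simp only [q, indicator, mem_Icc, max_le_iff, le_min_iff]
    have hiff : ((-c ≤ x ∧ x ≤ c) ∧ (-c ≤ s - x ∧ s - x ≤ c)) ↔ ((-c ≤ x ∧ s - c ≤ x) ∧ x ≤ c ∧ x ≤ s + c) := by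
      constructor
      · rintro ⟨⟨a, b⟩, d, e⟩
        exact ⟨⟨a, by linarith⟩, b, by linarith⟩
      · rintro ⟨⟨a, b⟩, d, e⟩
        exact ⟨⟨a, d⟩, by linarith, by linarith⟩
    simp only [← hiff]
    by_cases h1 : (-c ≤ x ∧ x ≤ c) <;> by_cases h2 : (-c ≤ s - x ∧ s - x ≤ c) <;> simp [h1, h2]
  rw [this, integral_indicator measurableSet_Icc]
  simp

open FourierTransform Convolution in
lemma cv_qq_fourier {c : ℝ} (hc : 0 < c) (s : ℝ) :
    cv (q c) (q c) s = (2 * c)^2 / (2 * Real.pi * c) * J 2 (s / c) := by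
  set Q : ℝ → ℂ := fun x => (q c x : ℂ) with hQ
  have hQi : Integrable Q := (q_good c).integrable.ofReal
  have hconv : (Q ⋆[ContinuousLinearMap.mul ℂ ℂ] Q) = fun s => ((cv (q c) (q c) s : ℝ) : ℂ) := by
    ext s
    unfold convolution cv
    rw [← integral_complex_ofReal]
    congr 1; ext x
    simp [hQ]
  have hFQ : ∀ ξ, 𝓕 Q ξ = ((2 * c * Real.sinc (2 * Real.pi * c * ξ) : ℝ) : ℂ) := by
    intro ξ
    rw [Real.fourier_real_eq_integral_exp_smul]
    have e1 : (fun v : ℝ => Complex.exp (↑(-2 * Real.pi * v * ξ) * Complex.I) • Q v) =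
        indicator (Icc (-c) c) (fun v : ℝ => Complex.exp (↑(-2 * Real.pi * v * ξ) * Complex.I)) := by
      ext v
      simp only [hQ, q, indicator]
      split_ifs <;> simp
    rw [e1, integral_indicator measurableSet_Icc, integral_Icc_eq_integral_Ioc,
      ← intervalIntegral.integral_of_le (by linarith)]
    by_cases hξ : ξ = 0
    · subst hξ; simp; ring
    · have := intervalIntegral.integral_comp_mul_left (a := -c) (b := c)
        (fun t : ℝ => Complex.exp (t * Complex.I)) (c := -2 * Real.pi * ξ) (by simp [hξ, Real.pi_ne_zero])
      have e2 : (fun v : ℝ => Complex.exp (↑(-2 * Real.pi * v * ξ) * Complex.I)) = fun v : ℝ => Complex.exp (↑(-2 * Real.pi * ξ * v) * Complex.I) := by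
        ext v; congr 3; ring
      rw [e2, this]
      have e3 : -2 * Real.pi * ξ * -c = - (-2 * Real.pi * ξ * c) := by ring
      rw [e3, integral_exp_mul_I_eq_sinc]
      have e4 : -2 * Real.pi * ξ * c = - (2 * Real.pi * c * ξ) := by ring
      rw [e4, Real.sinc_neg]
      have := Real.pi_ne_zero
      rw [Complex.real_smul]
      push_cast
      have h1 : (Real.pi : ℂ) ≠ 0 := by exact_mod_cast this
      have h2 : (ξ : ℂ) ≠ 0 := by exact_mod_cast hξ
      field_simp
  set h : ℝ → ℂ := (Q ⋆[ContinuousLinearMap.mul ℂ ℂ] Q) with hh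
  have hFh : 𝓕 h = fun ξ => (((2*c)^2 * Real.sinc (2 * Real.pi * c * ξ)^2 : ℝ) : ℂ) := by
    ext ξ
    rw [hh, Real.fourier_mul_convolution_eq hQi hQi, hFQ]
    push_cast; ring
  have hk : (2 * Real.pi * c) ≠ 0 := by have := Real.pi_pos; positivity
  have hFi : Integrable (𝓕 h) := by
    rw [hFh]
    refine Integrable.ofReal ?_
    refine Integrable.const_mul ?_ _
    exact (integrable_sinc_pow le_rfl).comp_mul_left' hk
  have hcont : Continuous h := by
    rw [hconv]
    simp only [cv_qq]
    fun_prop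
  have hi : Integrable h := by
    rw [hconv]
    exact ((q_good c).cv (q_good c)).integrable.ofReal
  have inv := congrFun (hcont.fourierInv_fourier_eq hi hFi) s
  rw [hFh, hconv, Real.fourierInv_eq_fourier_neg, Real.fourier_real_eq_integral_exp_smul] at inv
  have hre := congrArg Complex.re inv
  rw [Complex.ofReal_re] at hre
  rw [← hre]
  have hinteg : Integrable (fun v : ℝ => Complex.exp (↑(-2 * Real.pi * v * -s) * Complex.I) • (((2*c)^2 * Real.sinc (2 * Real.pi * c * v)^2 : ℝ) : ℂ)) := by
    rw [hFh] at hFi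
    refine hFi.norm.mono' (by fun_prop) (Filter.Eventually.of_forall fun v => ?_)
    rw [norm_smul, Complex.norm_exp_ofReal_mul_I, one_mul]
  have e5 := integral_re hinteg
  simp only [RCLike.re_to_complex] at e5
  rw [← e5]
  unfold J
  have e6 : (fun v : ℝ => (Complex.exp (↑(-2 * Real.pi * v * -s) * Complex.I) • (((2*c)^2 * Real.sinc (2 * Real.pi * c * v)^2 : ℝ) : ℂ)).re)
      = fun v => (fun t => (2*c)^2 * (Real.sinc t ^2 * Real.cos (t * (s / c)))) ((2 * Real.pi * c) * v) := by
    ext v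
    rw [smul_eq_mul, Complex.re_mul_ofReal, Complex.exp_ofReal_mul_I_re]
    have : -2 * Real.pi * v * -s = (2 * Real.pi * c) * v * (s / c) := by field_simp
    rw [this]; ring
  rw [e6, Measure.integral_comp_mul_left (fun t => (2*c)^2 * (Real.sinc t ^2 * Real.cos (t * (s / c)))) (2 * Real.pi * c), integral_const_mul, abs_of_pos (by have := Real.pi_pos; positivity), smul_eq_mul, div_eq_mul_inv ((2*c)^2)]
  ring

lemma int_cos {c : ℝ} (hc : 0 < c) (t s : ℝ) :
    ∫ x, q c x * Real.cos (t * ((s - x) / c)) = 2 * c * Real.sinc t * Real.cos (t * (s / c)) := by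
  have e1 : (fun x => q c x * Real.cos (t * ((s - x) / c))) =
      indicator (Icc (-c) c) (fun x => Real.cos (t * ((s - x) / c))) := by
    ext x; simp only [q, indicator]; split_ifs <;> simp
  rw [e1, integral_indicator measurableSet_Icc, integral_Icc_eq_integral_Ioc,
      ← intervalIntegral.integral_of_le (by linarith)]
  by_cases ht : t = 0
  · subst ht; simp; ring
  · have h : ∀ x ∈ uIcc (-c) c, HasDerivAt (fun x => -(c/t) * Real.sin (t * ((s - x) / c))) (Real.cos (t * ((s - x) / c))) x := by
      intro x _
      have h1 : HasDerivAt (fun x => t * ((s - x) / c)) (t * ((-1) / c)) x :=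
        (((hasDerivAt_id x).const_sub s).div_const c).const_mul t
      have := (h1.sin).const_mul (-(c/t))
      refine this.congr_deriv ?_
      field_simp
    rw [intervalIntegral.integral_eq_sub_of_hasDerivAt h (Continuous.intervalIntegrable (by fun_prop) _ _)]
    have a1 : t * ((s - c) / c) = t * (s/c) - t := by field_simp
    have a2 : t * ((s - -c) / c) = t * (s/c) + t := by field_simp; ring
    rw [a1, a2, Real.sin_sub, Real.sin_add, Real.sinc_of_ne_zero ht]
    field_simp
    ring

lemma w_formula {c : ℝ} (hc : 0 < c) : ∀ {m : ℕ}, 2 ≤ m → ∀ s,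
    cl (List.replicate m (q c)) s = (2*c)^m / (2 * Real.pi * c) * J m (s / c) := by
  intro m hm
  induction m, hm using Nat.le_induction with
  | base => intro s; exact cv_qq_fourier hc s
  | succ m hm ih =>
    intro s
    rw [List.replicate_succ, cl_cons _ (by simp; omega)]
    have e0 : cl (List.replicate m (q c)) = fun s => (2*c)^m / (2 * Real.pi * c) * J m (s / c) := funext ih
    rw [e0]
    unfold cv J
    have e1 : ∀ x, q c x * ((2*c)^m / (2 * Real.pi * c) * ∫ t, Real.sinc t ^ m * Real.cos (t * ((s - x)/c)))
       = (2*c)^m / (2 * Real.pi * c) * ∫ t, q c x * (Real.sinc t ^ m * Real.cos (t * ((s - x)/c))) := by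
      intro x; rw [integral_const_mul]; ring
    simp_rw [e1]
    rw [integral_const_mul, integral_integral_swap]
    · have e2 : ∀ t, ∫ x, q c x * (Real.sinc t ^ m * Real.cos (t * ((s - x)/c))) = 2 * c * (Real.sinc t ^ (m+1) * Real.cos (t * (s / c))) := by
        intro t
        have : ∀ x, q c x * (Real.sinc t ^ m * Real.cos (t * ((s - x)/c))) = Real.sinc t ^ m * (q c x * Real.cos (t * ((s - x)/c))) := by
          intro x; ring
        simp_rw [this]
        rw [integral_const_mul, int_cos hc]; ring
      simp_rw [e2]
      rw [integral_const_mul]; ring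
    · have := (((q_good c).integrable).mul_prod (integrable_sinc_pow hm)).mul_bdd (g := fun p : ℝ × ℝ => Real.cos (p.2 * ((s - p.1)/c))) (c := 1) ?_ (Filter.Eventually.of_forall fun p => ?_)
      · refine this.congr (Filter.Eventually.of_forall fun p => ?_)
        simp [Function.uncurry, mul_assoc]
      · exact Continuous.aestronglyMeasurable (by fun_prop)
      · exact Real.abs_cos_le_one _

end DiceAux

namespace DiceAux

/-- the set of admissible first coordinates -/
def Sset (m : ℕ) (c : ℝ) : Set (Fin m → ℝ) :=
  {a : Fin m → ℝ | (∀ i, a i ∈ Set.Icc (-c) c) ∧ (0 - ∑ i, a i) ∈ Set.Icc (-c) c}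

lemma Sset_meas (m : ℕ) (c : ℝ) : MeasurableSet (Sset m c) := by
  have : Sset m c = (⋂ i, (fun a : Fin m → ℝ => a i) ⁻¹' Icc (-c) c) ∩
      (fun a : Fin m → ℝ => 0 - ∑ i, a i) ⁻¹' Icc (-c) c := by
    ext a; simp [Sset]
  rw [this]
  refine MeasurableSet.inter ?_ ?_
  · exact MeasurableSet.iInter fun i => measurableSet_Icc.preimage (measurable_pi_apply i)
  · exact (measurableSet_Icc).preimage (f := fun a : Fin m → ℝ => 0 - ∑ i, a i) (by fun_prop)

lemma extendDie_castSucc (m : ℕ) (s : ℝ) (a : Fin m → ℝ) (i : Fin m) :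
    extendDie (m+1) s a i.castSucc = a i := by
  unfold extendDie
  simp

lemma extendDie_last (m : ℕ) (s : ℝ) (a : Fin m → ℝ) :
    extendDie (m+1) s a (Fin.last m) = s - ∑ j, a j := by
  unfold extendDie
  simp

lemma extendDie_meas (m : ℕ) (s : ℝ) : Measurable (extendDie (m+1) s) := by
  rw [measurable_pi_iff]
  intro i
  refine Fin.lastCases ?_ (fun j => ?_) i
  · have : (fun a => extendDie (m+1) s a (Fin.last m)) = fun a : Fin m → ℝ => s - ∑ j, a j := by
      ext a; exact extendDie_last m s a
    rw [this]
    fun_prop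
  · have : (fun a => extendDie (m+1) s a j.castSucc) = fun a : Fin m → ℝ => a j := by
      ext a; exact extendDie_castSucc m s a j
    rw [this]
    exact measurable_pi_apply j

lemma q_mem {c x : ℝ} (h : x ∈ Icc (-c) c) : q c x = 1 := by
  simp only [q, indicator_of_mem h]
lemma q_not_mem {c x : ℝ} (h : x ∉ Icc (-c) c) : q c x = 0 := by
  simp only [q, indicator_of_notMem h]

lemma Sset_indicator (m : ℕ) (c : ℝ) (Φ : Fin (m+1) → ℝ → ℝ) (a : Fin m → ℝ) :
    (Sset m c).indicator (fun a => ∏ k, Φ k (extendDie (m+1) 0 a k)) a =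
    (∏ i : Fin m, (q c (a i) * Φ i.castSucc (a i))) * (q c (0 - ∑ i, a i) * Φ (Fin.last m) (0 - ∑ i, a i)) := by
  by_cases h : a ∈ Sset m c
  · rw [indicator_of_mem h, Fin.prod_univ_castSucc, extendDie_last, q_mem h.2, one_mul]
    congr 1
    refine Finset.prod_congr rfl fun i _ => ?_
    rw [extendDie_castSucc, q_mem (h.1 i), one_mul]
  · rw [indicator_of_notMem h]
    by_cases h1 : (0 - ∑ i, a i) ∈ Icc (-c) c
    · have : ∃ i, a i ∉ Icc (-c) c := by
        by_contra h2
        push Not at h2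
        exact h ⟨h2, h1⟩
      obtain ⟨i, hi⟩ := this
      rw [Finset.prod_eq_zero (Finset.mem_univ i) (by rw [q_not_mem hi, zero_mul]), zero_mul]
    · rw [q_not_mem h1]; simp

lemma vol_S (m : ℕ) (c : ℝ) : volume.real (Sset m c) = cl (List.replicate (m+1) (q c)) 0 := by
  have h := pi_integral (m := m) (fun _ => q c) (fun _ => q_good c) 0
  rw [List.ofFn_const] at h
  rw [← h, ← integral_indicator_one (Sset_meas m c)]
  congr 1; ext a
  have := Sset_indicator m c (fun _ _ => 1) a
  simp only [mul_one, Finset.prod_const_one] at this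
  rw [← this]; rfl

lemma law_prod (m : ℕ) (c : ℝ) (Φ : Fin (m+1) → ℝ → ℝ) (hm : ∀ k, Measurable (Φ k))
    (hΦ : ∀ k, Good (fun x => q c x * Φ k x)) :
    ∫ A, ∏ k, Φ k (A k) ∂(diceMeasure (m+1) (-c) c 0) =
      (volume.real (Sset m c))⁻¹ * cl (List.ofFn (fun k x => q c x * Φ k x)) 0 := by
  have hd : diceMeasure (m+1) (-c) c 0 = Measure.map (extendDie (m+1) 0) ((volume (Sset m c))⁻¹ • volume.restrict (Sset m c)) := rfl
  rw [hd, integral_map (extendDie_meas m 0).aemeasurable, integral_smul_measure]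
  · change _ • (∫ (x : Fin m → ℝ) in Sset m c, ∏ k, Φ k (extendDie (m + 1) 0 x k)) = _
    rw [← integral_indicator (Sset_meas m c), ← pi_integral _ hΦ, smul_eq_mul, ENNReal.toReal_inv, measureReal_def]
    congr 2
    ext a
    exact Sset_indicator m c Φ a
  · refine Measurable.aestronglyMeasurable ?_
    exact Finset.measurable_fun_prod _ fun k _ => (hm k).comp (measurable_pi_apply k)

lemma finrange_perm (n : ℕ) (i : Fin n) : (List.finRange n).Perm (i :: (List.finRange n).erase i) :=
  List.perm_cons_erase (List.mem_finRange i)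

lemma cl_single {m : ℕ} {Q K : ℝ → ℝ} (Ψ : Fin (m+2) → ℝ → ℝ) (i : Fin (m+2)) (hQ : Good Q) (hK : Good K)
   (hi : Ψ i = K) (hj : ∀ j, j ≠ i → Ψ j = Q) :
   cl (List.ofFn Ψ) = cv K (cl (List.replicate (m+1) Q)) := by
  have hg : ∀ F ∈ List.ofFn Ψ, Good F := by
    intro F hF
    obtain ⟨j, rfl⟩ := (List.mem_ofFn' _ _).1 hF
    by_cases h : j = i
    · rw [h, hi]; exact hK
    · rw [hj j h]; exact hQ
  have hp : (List.ofFn Ψ).Perm (K :: List.replicate (m+1) Q) := by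
    rw [List.ofFn_eq_map]
    refine ((finrange_perm _ i).map Ψ).trans ?_
    rw [List.map_cons, hi]
    refine List.Perm.of_eq ?_
    congr 1
    rw [List.eq_replicate_iff]
    refine ⟨by simp [List.length_erase_of_mem], ?_⟩
    intro F hF
    obtain ⟨j, hj1, rfl⟩ := List.mem_map.1 hF
    exact hj j (((List.nodup_finRange _).mem_erase_iff).1 hj1).1
  rw [cl_perm hp hg, cl_cons _ (by simp)]

lemma cl_pair {m : ℕ} {Q K L : ℝ → ℝ} (Ψ : Fin (m+3) → ℝ → ℝ) (i j : Fin (m+3)) (hij : j ≠ i) (hQ : Good Q) (hK : Good K) (hL : Good L)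
   (hi : Ψ i = K) (hj : Ψ j = L) (hk : ∀ k, k ≠ i → k ≠ j → Ψ k = Q) :
   cl (List.ofFn Ψ) = cv K (cv L (cl (List.replicate (m+1) Q))) := by
  have hg : ∀ F ∈ List.ofFn Ψ, Good F := by
    intro F hF
    obtain ⟨k, rfl⟩ := (List.mem_ofFn' _ _).1 hF
    by_cases h : k = i
    · rw [h, hi]; exact hK
    · by_cases h2 : k = j
      · rw [h2, hj]; exact hL
      · rw [hk k h h2]; exact hQ
  have hn := List.nodup_finRange (m+3)
  have hp : (List.ofFn Ψ).Perm (K :: L :: List.replicate (m+1) Q) := by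
    rw [List.ofFn_eq_map]
    have hjm : j ∈ (List.finRange (m+3)).erase i := (hn.mem_erase_iff).2 ⟨hij, List.mem_finRange j⟩
    refine (((finrange_perm _ i).trans ((List.perm_cons_erase hjm).cons i)).map Ψ).trans ?_
    rw [List.map_cons, List.map_cons, hi, hj]
    refine List.Perm.of_eq ?_
    congr 2
    rw [List.eq_replicate_iff]
    refine ⟨by simp [List.length_erase_of_mem, hjm], ?_⟩
    intro F hF
    obtain ⟨k, hk1, rfl⟩ := List.mem_map.1 hF
    have h1 := ((hn.erase i).mem_erase_iff).1 hk1
    exact hk k (hn.mem_erase_iff.1 h1.2).1 h1.1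
  rw [cl_perm hp hg, cl_cons _ (by simp), cl_cons _ (by simp)]

end DiceAux

namespace DiceAux

/-- the uniform law on `[-c,c]` -/
noncomputable def U (c : ℝ) : Measure ℝ := ENNReal.ofReal (2*c)⁻¹ • volume.restrict (Icc (-c) c)

lemma U_prob {c : ℝ} (hc : 0 < c) : IsProbabilityMeasure (U c) := by
  constructor
  unfold U
  rw [Measure.smul_apply, Measure.restrict_apply_univ, Real.volume_Icc, smul_eq_mul,
    ← ENNReal.ofReal_mul (by positivity)]
  rw [show (2*c)⁻¹ * (c - -c) = 1 by field_simp; ring]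
  simp

lemma U_ae (c : ℝ) : ∀ᵐ x ∂(U c), x ∈ Icc (-c) c := by
  unfold U
  exact Measure.ae_smul_measure (ae_restrict_mem measurableSet_Icc) _

lemma U_int' {c : ℝ} (hc : 0 < c) (f : ℝ → ℝ) : ∫ x, f x ∂(U c) = (2*c)⁻¹ * ∫ x in Icc (-c) c, f x := by
  unfold U
  rw [integral_smul_measure, smul_eq_mul, ENNReal.toReal_ofReal (by positivity)]

lemma U_int {c : ℝ} (hc : 0 < c) (f : ℝ → ℝ) : ∫ x, f x ∂(U c) = (2*c)⁻¹ * ∫ x, q c x * f x := by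
  rw [U_int' hc, ← integral_indicator measurableSet_Icc]
  congr 2; ext x
  simp only [q, indicator]; split_ifs <;> simp

lemma good_qf {c B : ℝ} {f : ℝ → ℝ} (hf : Measurable f) (hB0 : 0 ≤ B) (hB : ∀ x ∈ Icc (-c) c, |f x| ≤ B) :
    Good (fun x => q c x * f x) := by
  refine ⟨(q_good c).meas.mul hf, ⟨B, hB0, fun x => ?_⟩, ⟨c, fun x hx => ?_⟩⟩
  · by_cases h : x ∈ Icc (-c) c
    · rw [q_mem h, one_mul]; exact hB x h
    · rw [q_not_mem h]; simpa
  · rw [q_not_mem, zero_mul]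
    rintro ⟨h1, h2⟩
    exact absurd (abs_le.2 ⟨h1, h2⟩) (not_le.2 hx)

lemma J_meas {m : ℕ} (hm : 2 ≤ m) : Measurable (J m) := by
  have h := (cl_good (List.replicate m (q 1)) (fun F hF => by
    rw [List.eq_of_mem_replicate hF]; exact q_good 1)).meas
  have e : J m = fun s => ((2*1)^m / (2 * Real.pi * 1))⁻¹ * cl (List.replicate m (q 1)) s := by
    ext s
    rw [w_formula one_pos hm, div_one, ← mul_assoc, inv_mul_cancel₀, one_mul]
    have := Real.pi_pos
    positivity
  rw [e]
  exact h.const_mul _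

lemma vol_J {m : ℕ} {c : ℝ} (hc : 0 < c) (hm : 1 ≤ m) :
    volume.real (Sset m c) = (2*c)^(m+1) / (2 * Real.pi * c) * J (m+1) 0 := by
  rw [vol_S, w_formula hc (by omega), zero_div]

lemma law1 {m : ℕ} {c B : ℝ} (hc : 0 < c) (hm : 1 ≤ m) {f : ℝ → ℝ} (hf : Measurable f) (hB0 : 0 ≤ B)
    (hB : ∀ x ∈ Icc (-c) c, |f x| ≤ B) (hJ : 0 < J (m+2) 0) (i : Fin (m+2)) :
    ∫ A, f (A i) ∂(diceMeasure (m+2) (-c) c 0) = ∫ x, f x * (J (m+1) (-x/c) / J (m+2) 0) ∂(U c) := by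
  classical
  set Φ : Fin (m+2) → ℝ → ℝ := fun k => if k = i then f else fun _ => 1 with hΦ
  have h1 : ∀ A : Fin (m+2) → ℝ, f (A i) = ∏ k, Φ k (A k) := by
    intro A
    rw [Finset.prod_eq_single i]
    · simp [hΦ]
    · intro b _ hb; simp [hΦ, hb]
    · simp
  simp_rw [h1]
  have hm1 : ∀ k, Measurable (Φ k) := by
    intro k; simp only [hΦ]; split_ifs
    · exact hf
    · exact measurable_const
  have hg : ∀ k, Good (fun x => q c x * Φ k x) := by
    intro k; simp only [hΦ]; split_ifs
    · exact good_qf hf hB0 hB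
    · simpa using q_good c
  rw [law_prod (m+1) c Φ hm1 hg, cl_single (Q := q c) (K := fun x => q c x * f x) _ i (q_good c) (good_qf hf hB0 hB)
    (by simp [hΦ]) (by intro j hj; simp [hΦ, hj]), vol_J hc (by omega), U_int hc]
  unfold cv
  simp_rw [w_formula hc (show 2 ≤ m + 1 by omega)]
  rw [← integral_const_mul, ← integral_const_mul]
  congr 1; ext x
  have := Real.pi_pos
  rw [zero_sub]
  generalize J (m+1) (-x/c) = j
  field_simp
  ring

lemma law2 {m : ℕ} {c B B' : ℝ} (hc : 0 < c) (hm : 1 ≤ m) {f g : ℝ → ℝ} (hf : Measurable f) (hB0 : 0 ≤ B)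
    (hB : ∀ x ∈ Icc (-c) c, |f x| ≤ B) (hg : Measurable g) (hB0' : 0 ≤ B')
    (hB' : ∀ x ∈ Icc (-c) c, |g x| ≤ B') (hJ : 0 < J (m+3) 0) (i j : Fin (m+3)) (hij : j ≠ i) :
    ∫ A, f (A i) * g (A j) ∂(diceMeasure (m+3) (-c) c 0) =
      ∫ x, ∫ y, f x * g y * (J (m+1) ((-x-y)/c) / J (m+3) 0) ∂(U c) ∂(U c) := by
  classical
  set Φ : Fin (m+3) → ℝ → ℝ := fun k => if k = i then f else if k = j then g else fun _ => 1 with hΦ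
  have h1 : ∀ A : Fin (m+3) → ℝ, f (A i) * g (A j) = ∏ k, Φ k (A k) := by
    intro A
    rw [Finset.prod_eq_mul i j hij.symm]
    · simp [hΦ, hij]
    · intro b _ hb; simp [hΦ, hb.1, hb.2]
    · simp
    · simp
  simp_rw [h1]
  have hm1 : ∀ k, Measurable (Φ k) := by
    intro k; simp only [hΦ]; split_ifs
    · exact hf
    · exact hg
    · exact measurable_const
  have hgd : ∀ k, Good (fun x => q c x * Φ k x) := by
    intro k; simp only [hΦ]; split_ifs
    · exact good_qf hf hB0 hB
    · exact good_qf hg hB0' hB'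
    · simpa using q_good c
  rw [law_prod (m+2) c Φ hm1 hgd, cl_pair (Q := q c) (K := fun x => q c x * f x) (L := fun x => q c x * g x) _ i j hij (q_good c) (good_qf hf hB0 hB) (good_qf hg hB0' hB')
    (by simp [hΦ]) (by simp [hΦ, hij]) (by intro k hk hk'; simp [hΦ, hk, hk']), vol_J hc (by omega), U_int hc, cv_cv_apply]
  simp_rw [w_formula hc (show 2 ≤ m + 1 by omega), U_int hc]
  rw [← integral_const_mul, ← integral_const_mul]
  congr 1; ext x
  simp_rw [← integral_const_mul]
  congr 1; ext y
  have := Real.pi_pos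
  rw [zero_sub]
  generalize J (m+1) ((-x-y)/c) = j
  field_simp
  ring

lemma dice_prob {m : ℕ} {c : ℝ} (hc : 0 < c) (hm : 1 ≤ m) (hJ : 0 < J (m+1) 0) :
    IsProbabilityMeasure (diceMeasure (m+1) (-c) c 0) := by
  have hv := vol_J hc hm
  have hpos : 0 < volume.real (Sset m c) := by
    rw [hv]; have := Real.pi_pos; positivity
  rw [measureReal_def, ENNReal.toReal_pos_iff] at hpos
  have h1 : IsProbabilityMeasure (ProbabilityTheory.cond volume (Sset m c)) :=
    cond_isProbabilityMeasure_of_finite hpos.1.ne' hpos.2.ne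
  have h2 : IsProbabilityMeasure (Measure.map (extendDie (m+1) 0) (ProbabilityTheory.cond volume (Sset m c))) :=
    Measure.isProbabilityMeasure_map (μ := ProbabilityTheory.cond volume (Sset m c)) (extendDie_meas m 0).aemeasurable
  exact h2

lemma dice_ae (m : ℕ) (c : ℝ) :
    ∀ᵐ A ∂(diceMeasure (m+1) (-c) c 0), ∀ i, A i ∈ Icc (-c) c := by
  have h : ∀ᵐ a ∂(ProbabilityTheory.cond volume (Sset m c)), ∀ i, extendDie (m+1) 0 a i ∈ Icc (-c) c := by
    filter_upwards [ae_cond_mem (Sset_meas m c)] with a ha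
    intro i
    refine Fin.lastCases ?_ (fun j => ?_) i
    · rw [extendDie_last]; exact ha.2
    · rw [extendDie_castSucc]; exact ha.1 j
  refine (ae_map_iff (extendDie_meas m 0).aemeasurable ?_).2 h
  have : {A : Fin (m+1) → ℝ | ∀ i, A i ∈ Icc (-c) c} = ⋂ i, (fun a : Fin (m+1) → ℝ => a i) ⁻¹' Icc (-c) c := by
    ext a; simp
  rw [this]
  exact MeasurableSet.iInter fun i => measurableSet_Icc.preimage (measurable_pi_apply i)

/-- bounded measurable functions are integrable for the uniform law -/
lemma U_integrable {c B : ℝ} (hc : 0 < c) {f : ℝ → ℝ} (hf : Measurable f) (hB : ∀ x ∈ Icc (-c) c, |f x| ≤ B) :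
    Integrable f (U c) := by
  have := U_prob hc
  refine Integrable.of_bound hf.aestronglyMeasurable B ?_
  filter_upwards [U_ae c] with x hx
  exact hB x hx

lemma law1_approx {m : ℕ} {c B D : ℝ} (hc : 0 < c) (hm : 1 ≤ m) {f : ℝ → ℝ} (hf : Measurable f) (hB0 : 0 ≤ B)
    (hB : ∀ x ∈ Icc (-c) c, |f x| ≤ B) (hJ : 0 < J (m+2) 0)
    (hD : ∀ s, |s| ≤ 1 → |J (m+1) s / J (m+2) 0 - 1| ≤ D) (i : Fin (m+2)) :
    |∫ A, f (A i) ∂(diceMeasure (m+2) (-c) c 0) - ∫ x, f x ∂(U c)| ≤ B * D := by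
  have := U_prob hc
  have hs : ∀ x ∈ Icc (-c) c, |(-x/c)| ≤ 1 := by
    intro x hx
    rw [abs_div, abs_neg, abs_of_pos hc, div_le_one hc]
    exact abs_le.2 hx
  have hD0 : 0 ≤ D := (abs_nonneg _).trans (hD 0 (by simp))
  rw [law1 hc hm hf hB0 hB hJ, ← integral_sub]
  · have h2 : ∀ᵐ x ∂(U c), ‖f x * (J (m+1) (-x/c) / J (m+2) 0) - f x‖ ≤ B * D := by
      filter_upwards [U_ae c] with x hx
      rw [Real.norm_eq_abs, show f x * (J (m+1) (-x/c) / J (m+2) 0) - f x = f x * (J (m+1) (-x/c) / J (m+2) 0 - 1) by ring, abs_mul]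
      exact mul_le_mul (hB x hx) (hD _ (hs x hx)) (abs_nonneg _) hB0
    have h3 := norm_integral_le_of_norm_le_const h2
    simpa using h3
  · refine U_integrable (B := B * (D + 1)) hc (hf.mul (((J_meas (by omega)).comp (by fun_prop)).div_const _)) ?_
    intro x hx
    rw [abs_mul]
    refine mul_le_mul (hB x hx) ?_ (abs_nonneg _) hB0
    have h5 := hD _ (hs x hx)
    have h6 := abs_sub_abs_le_abs_sub (J (m+1) (-x/c) / J (m+2) 0) 1
    rw [abs_one] at h6
    linarith
  · exact U_integrable hc hf hB

lemma law2_approx {m : ℕ} {c B B' α β D : ℝ} (hc : 0 < c) (hm : 1 ≤ m) {f g : ℝ → ℝ} (hf : Measurable f) (hB0 : 0 ≤ B)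
    (hB : ∀ x ∈ Icc (-c) c, |f x| ≤ B) (hg : Measurable g) (hB0' : 0 ≤ B')
    (hB' : ∀ x ∈ Icc (-c) c, |g x| ≤ B') (hJ : 0 < J (m+3) 0)
    (hD : ∀ s, |s| ≤ 2 → |J (m+1) s / J (m+3) 0 - (α - β * s^2)| ≤ D)
    (hf0 : ∫ x, f x ∂(U c) = 0) (hg0 : ∫ x, g x ∂(U c) = 0)
    (i j : Fin (m+3)) (hij : j ≠ i) :
    |∫ A, f (A i) * g (A j) ∂(diceMeasure (m+3) (-c) c 0)
      + 2 * β / c^2 * ((∫ x, x * f x ∂(U c)) * ∫ x, x * g x ∂(U c))| ≤ B * B' * D := by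
  have := U_prob hc
  have hs : ∀ x ∈ Icc (-c) c, ∀ y ∈ Icc (-c) c, |(-x-y)/c| ≤ 2 := by
    intro x hx y hy
    rw [abs_div, abs_of_pos hc, div_le_iff₀ hc, abs_le]
    constructor <;> linarith [hx.1, hx.2, hy.1, hy.2]
  have hD0 : 0 ≤ D := (abs_nonneg _).trans (hD 0 (by simp))
  have fi : Integrable f (U c) := U_integrable hc hf hB
  have gi : Integrable g (U c) := U_integrable hc hg hB'
  have bx : ∀ x ∈ Icc (-c) c, |x| ≤ c := fun x hx => abs_le.2 hx
  have xfi : ∀ {h : ℝ → ℝ} {K : ℝ}, 0 ≤ K → Measurable h → (∀ x ∈ Icc (-c) c, |h x| ≤ K) → Integrable (fun x => x * h x) (U c) := by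
    intro h K hK hh hb
    refine U_integrable (B := c * K) hc (measurable_id.mul hh) fun x hx => ?_
    rw [abs_mul]
    exact mul_le_mul (bx x hx) (hb x hx) (abs_nonneg _) hc.le
  have xxfi : ∀ {h : ℝ → ℝ} {K : ℝ}, 0 ≤ K → Measurable h → (∀ x ∈ Icc (-c) c, |h x| ≤ K) → Integrable (fun x => x * (x * h x)) (U c) := by
    intro h K hK hh hb
    refine xfi (K := c * K) (by positivity) (measurable_id.mul hh) fun x hx => ?_
    rw [abs_mul]
    exact mul_le_mul (bx x hx) (hb x hx) (abs_nonneg _) hc.le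
  set P : ℝ → ℝ → ℝ := fun x y => f x * g y * (α - β * ((-x-y)/c)^2) with hP
  set b := β / c^2 with hb
  have hPe : ∀ x y, P x y = (α * f x - b * (x * (x * f x))) * g y - (2 * b * (x * f x)) * (y * g y) - (b * f x) * (y * (y * g y)) := by
    intro x y
    simp only [hP, hb]
    field_simp
    ring
  have e1 : ∀ x, ∫ y, P x y ∂(U c) = -(2 * b * (∫ y, y * g y ∂(U c))) * (x * f x) - (b * (∫ y, y * (y * g y) ∂(U c))) * f x := by
    intro x
    simp_rw [hPe]
    have i1 : Integrable (fun y => (α * f x - b * (x * (x * f x))) * g y) (U c) := gi.const_mul _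
    have i2 : Integrable (fun y => (2 * b * (x * f x)) * (y * g y)) (U c) := (xfi hB0' hg hB').const_mul _
    have i3 : Integrable (fun y => (b * f x) * (y * (y * g y))) (U c) := (xxfi hB0' hg hB').const_mul _
    have i12 : Integrable (fun y => (α * f x - b * (x * (x * f x))) * g y - (2 * b * (x * f x)) * (y * g y)) (U c) := i1.sub i2
    rw [integral_sub i12 i3, integral_sub i1 i2, integral_const_mul, integral_const_mul, integral_const_mul, hg0]
    ring
  have e2 : ∫ x, ∫ y, P x y ∂(U c) ∂(U c) = - (2 * β / c^2 * ((∫ x, x * f x ∂(U c)) * ∫ x, x * g x ∂(U c))) := by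
    simp_rw [e1]
    rw [integral_sub ((xfi hB0 hf hB).const_mul _) (fi.const_mul _), integral_const_mul, integral_const_mul, hf0]
    simp only [hb]
    ring
  have e3 : ∫ A, f (A i) * g (A j) ∂(diceMeasure (m+3) (-c) c 0)
      + 2 * β / c^2 * ((∫ x, x * f x ∂(U c)) * ∫ x, x * g x ∂(U c)) =
      ∫ x, ∫ y, f x * g y * (J (m+1) ((-x-y)/c) / J (m+3) 0) ∂(U c) ∂(U c) - ∫ x, ∫ y, P x y ∂(U c) ∂(U c) := by
    rw [law2 hc hm hf hB0 hB hg hB0' hB' hJ i j hij, e2]; ring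
  have mJ := J_meas (show 2 ≤ m + 1 by omega)
  have aeprod : ∀ᵐ p ∂((U c).prod (U c)), p.1 ∈ Icc (-c) c ∧ p.2 ∈ Icc (-c) c :=
    (Measure.quasiMeasurePreserving_fst.ae (U_ae c)).and (Measure.quasiMeasurePreserving_snd.ae (U_ae c))
  have fgi : Integrable (fun p : ℝ × ℝ => f p.1 * g p.2) ((U c).prod (U c)) := fi.mul_prod gi
  have iP : Integrable (fun p : ℝ × ℝ => P p.1 p.2) ((U c).prod (U c)) := by
    refine fgi.mul_bdd (c := |α| + |β| * 4) (by fun_prop) ?_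
    filter_upwards [aeprod] with p hp
    have h1 := hs _ hp.1 _ hp.2
    have h2 : ((-p.1-p.2)/c)^2 ≤ 4 := by
      rw [← sq_abs]
      nlinarith [abs_nonneg ((-p.1-p.2)/c)]
    rw [Real.norm_eq_abs]
    refine (abs_sub _ _).trans ?_
    rw [abs_mul, abs_of_nonneg (sq_nonneg ((-p.1-p.2)/c))]
    gcongr
  have iD : Integrable (fun p : ℝ × ℝ => f p.1 * g p.2 * (J (m+1) ((-p.1-p.2)/c) / J (m+3) 0 - (α - β * ((-p.1-p.2)/c)^2))) ((U c).prod (U c)) := by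
    refine fgi.mul_bdd (c := D) ?_ ?_
    · refine Measurable.aestronglyMeasurable ?_
      refine Measurable.sub ((mJ.comp (by fun_prop)).div_const _) (by fun_prop)
    · filter_upwards [aeprod] with p hp
      exact hD _ (hs _ hp.1 _ hp.2)
  have iJ : Integrable (fun p : ℝ × ℝ => f p.1 * g p.2 * (J (m+1) ((-p.1-p.2)/c) / J (m+3) 0)) ((U c).prod (U c)) := by
    refine (iD.add iP).congr (Filter.Eventually.of_forall fun p => ?_)
    simp only [hP, Pi.add_apply]
    ring
  rw [e3, ← integral_prod (fun p : ℝ × ℝ => f p.1 * g p.2 * (J (m+1) ((-p.1-p.2)/c) / J (m+3) 0)) iJ,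
    ← integral_prod (fun p : ℝ × ℝ => P p.1 p.2) iP, ← integral_sub iJ iP]
  have h2 : ∀ᵐ p ∂((U c).prod (U c)), ‖f p.1 * g p.2 * (J (m+1) ((-p.1-p.2)/c) / J (m+3) 0) - P p.1 p.2‖ ≤ B * B' * D := by
    filter_upwards [aeprod] with p hp
    simp only [hP]
    rw [← mul_sub, Real.norm_eq_abs, abs_mul, abs_mul]
    exact mul_le_mul (mul_le_mul (hB _ hp.1) (hB' _ hp.2) (abs_nonneg _) hB0) (hD _ (hs _ hp.1 _ hp.2)) (abs_nonneg _) (by positivity)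
  have h3 := norm_integral_le_of_norm_le_const h2
  simpa using h3

end DiceAux

namespace DiceAux

lemma poly_gen (N : ℕ) (p : ℕ → ℝ) (a b : ℝ) :
    ∫ t in a..b, ∑ k ∈ Finset.range N, p k * t^k = ∑ k ∈ Finset.range N, p k * ((b^(k+1) - a^(k+1)) / ((k:ℝ)+1)) := by
  rw [intervalIntegral.integral_finsetSum]
  · refine Finset.sum_congr rfl fun k _ => ?_
    rw [intervalIntegral.integral_const_mul, integral_pow]
  · intro k _
    exact Continuous.intervalIntegrable (by fun_prop) _ _

lemma poly6 (p0 p1 p2 p3 p4 p5 p6 a b : ℝ) :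
    ∫ t in a..b, (p0 + p1 * t + p2 * t^2 + p3 * t^3 + p4 * t^4 + p5 * t^5 + p6 * t^6) =
    p0 * (b - a) + p1 * ((b^2-a^2)/2) + p2 * ((b^3-a^3)/3) + p3 * ((b^4-a^4)/4) + p4 * ((b^5-a^5)/5)
     + p5 * ((b^6-a^6)/6) + p6 * ((b^7-a^7)/7) := by
  have h := poly_gen 7 (fun k => [p0,p1,p2,p3,p4,p5,p6].getD k 0) a b
  simp only [Finset.sum_range_succ, Finset.sum_range_zero] at h
  norm_num at h
  rw [h]

lemma poly_eq {f : ℝ → ℝ} (p0 p1 p2 p3 p4 p5 p6 a b : ℝ)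
    (h : ∀ t, f t = p0 + p1 * t + p2 * t^2 + p3 * t^3 + p4 * t^4 + p5 * t^5 + p6 * t^6) :
    ∫ t in a..b, f t =
    p0 * (b - a) + p1 * ((b^2-a^2)/2) + p2 * ((b^3-a^3)/3) + p3 * ((b^4-a^4)/4) + p4 * ((b^5-a^5)/5)
     + p5 * ((b^6-a^6)/6) + p6 * ((b^7-a^7)/7) := by
  simp_rw [h]
  exact poly6 ..

/-- split an integral over `[0,1]` of a function which is piecewise continuous -/
lemma split_int {f g h : ℝ → ℝ} {u : ℝ} (hu : u ∈ Icc (0:ℝ) 1) (hg : Continuous g) (hh : Continuous h)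
    (h1 : ∀ t, t < u → f t = g t) (h2 : ∀ t, u < t → f t = h t) :
    ∫ t in (0:ℝ)..1, f t = (∫ t in (0:ℝ)..u, g t) + ∫ t in u..1, h t := by
  have hne : ∀ᵐ t : ℝ, t ≠ u := by
    simp [ae_iff, measure_singleton]
  have a1 : ∀ᵐ t : ℝ, t ∈ Ioc 0 u → f t = g t := by
    filter_upwards [hne] with t ht htu
    exact h1 t (lt_of_le_of_ne htu.2 ht)
  have a2 : ∀ᵐ t : ℝ, t ∈ Ioc u 1 → f t = h t := by
    filter_upwards with t ht
    exact h2 t ht.1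
  have i1 : IntervalIntegrable f volume 0 u := by
    refine (hg.intervalIntegrable 0 u).congr_ae ?_
    rw [uIoc_of_le hu.1]
    exact (ae_restrict_iff' measurableSet_Ioc).2 (a1.mono fun t ht hh => (ht hh).symm)
  have i2 : IntervalIntegrable f volume u 1 := by
    refine (hh.intervalIntegrable u 1).congr_ae ?_
    rw [uIoc_of_le hu.2]
    exact (ae_restrict_iff' measurableSet_Ioc).2 (a2.mono fun t ht hh => (ht hh).symm)
  rw [← intervalIntegral.integral_add_adjacent_intervals i1 i2]
  congr 1
  · refine intervalIntegral.integral_congr_ae ?_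
    rw [uIoc_of_le hu.1]; exact a1
  · refine intervalIntegral.integral_congr_ae ?_
    rw [uIoc_of_le hu.2]; exact a2

noncomputable def ke (u t : ℝ) : ℝ := (if t ≤ u then 1 else 0) + (t - u) - 1/2

noncomputable def b2 (u : ℝ) : ℝ := u^2 - u + 1/6

lemma ke_le {u t : ℝ} (h : t ≤ u) : ke u t = t - u + 1/2 := by
  unfold ke; rw [if_pos h]; ring
lemma ke_gt {u t : ℝ} (h : u < t) : ke u t = t - u - 1/2 := by
  unfold ke; rw [if_neg (not_le.2 h)]; ring

lemma ke_int_right {u : ℝ} (hu : u ∈ Icc (0:ℝ) 1) : ∫ t in (0:ℝ)..1, ke u t = 0 := by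
  rw [split_int (g := fun t => t - u + 1/2) (h := fun t => t - u - 1/2) hu (by fun_prop) (by fun_prop)
    (fun t ht => ke_le ht.le) (fun t ht => ke_gt ht),
    poly_eq (-u + 1/2) 1 0 0 0 0 0 _ _ (by intro t; ring), poly_eq (-u - 1/2) 1 0 0 0 0 0 _ _ (by intro t; ring)]
  ring

lemma ke_int_left {t : ℝ} (ht : t ∈ Icc (0:ℝ) 1) : ∫ u in (0:ℝ)..1, ke u t = 0 := by
  rw [split_int (g := fun u => t - u - 1/2) (h := fun u => t - u + 1/2) ht (by fun_prop) (by fun_prop)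
    (fun u hu => ke_gt hu) (fun u hu => ke_le hu.le),
    poly_eq (t - 1/2) (-1) 0 0 0 0 0 _ _ (by intro t; ring), poly_eq (t + 1/2) (-1) 0 0 0 0 0 _ _ (by intro t; ring)]
  ring

lemma ke_mom {u : ℝ} (hu : u ∈ Icc (0:ℝ) 1) : ∫ t in (0:ℝ)..1, (2*t-1) * ke u t = b2 u := by
  rw [split_int (g := fun t => (2*t-1)*(t - u + 1/2)) (h := fun t => (2*t-1)*(t - u - 1/2)) hu (by fun_prop) (by fun_prop)
    (fun t ht => by rw [ke_le ht.le]) (fun t ht => by rw [ke_gt ht]),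
    poly_eq (u - 1/2) (-2*u) 2 0 0 0 0 _ _ (by intro t; ring), poly_eq (u + 1/2) (-2*u-2) 2 0 0 0 0 _ _ (by intro t; ring)]
  unfold b2
  ring

lemma ke_cov_le {u v : ℝ} (hu : u ∈ Icc (0:ℝ) 1) (hv : v ∈ Icc (0:ℝ) 1) (huv : u ≤ v) :
    ∫ t in (0:ℝ)..1, ke u t * ke v t = b2 (v - u) / 2 := by
  have hdec : ∀ t, ke u t * ke v t = (if t ≤ u then (t - v + 1/2) else 0) + (t - u - 1/2) * ke v t := by
    intro t
    by_cases h : t ≤ u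
    · rw [ke_le h, ke_le (h.trans huv), if_pos h]; ring
    · rw [ke_gt (not_le.1 h), if_neg h]; ring
  have m1 : IntervalIntegrable (fun t => if t ≤ u then (t - v + 1/2) else 0) volume 0 1 := by
    have : (fun t => if t ≤ u then (t - v + 1/2) else 0) = indicator (Iic u) (fun t => t - v + 1/2) := by
      ext t; simp [indicator]
    rw [this, intervalIntegrable_iff]
    exact ((Continuous.intervalIntegrable (by fun_prop) 0 1).def').indicator measurableSet_Iic
  have m2 : IntervalIntegrable (fun t => (t - u - 1/2) * ke v t) volume 0 1 := by
    have : (fun t => (t - u - 1/2) * ke v t) = fun t => indicator (Iic v) (fun t => t - u - 1/2) t + (t - u - 1/2) * (t - v - 1/2) := by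
      ext t; unfold ke
      by_cases h : t ≤ v
      · rw [indicator_of_mem (mem_Iic.2 h), if_pos h]; ring
      · rw [indicator_of_notMem (fun h2 => h (mem_Iic.1 h2)), if_neg h]; ring
    rw [this]
    refine IntervalIntegrable.add ?_ (Continuous.intervalIntegrable (by fun_prop) 0 1)
    rw [intervalIntegrable_iff]
    exact ((Continuous.intervalIntegrable (by fun_prop) 0 1).def').indicator measurableSet_Iic
  simp_rw [hdec]
  rw [intervalIntegral.integral_add m1 m2,
   split_int (g := fun t => (t - v + 1/2)) (h := fun t => 0) hu (by fun_prop) (by fun_prop)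
    (fun t ht => by rw [if_pos ht.le]) (fun t ht => by rw [if_neg (not_le.2 ht)]),
   split_int (g := fun t => (t - u - 1/2) * (t - v + 1/2)) (h := fun t => (t - u - 1/2) * (t - v - 1/2)) hv (by fun_prop) (by fun_prop)
    (fun t ht => by rw [ke_le ht.le]) (fun t ht => by rw [ke_gt ht]),
   poly_eq (-v + 1/2) 1 0 0 0 0 0 0 u (by intro t; ring),
   poly_eq ((-u-1/2)*(-v + 1/2)) (-u-v) 1 0 0 0 0 0 v (by intro t; ring),
   poly_eq ((-u-1/2)*(-v - 1/2)) (-u-v-1) 1 0 0 0 0 v 1 (by intro t; ring)]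
  unfold b2
  simp
  ring

lemma ke_cov {u v : ℝ} (hu : u ∈ Icc (0:ℝ) 1) (hv : v ∈ Icc (0:ℝ) 1) :
    ∫ t in (0:ℝ)..1, ke u t * ke v t = b2 |u - v| / 2 := by
  rcases le_total u v with h | h
  · rw [ke_cov_le hu hv h, abs_sub_comm, abs_of_nonneg (by linarith)]
  · simp_rw [mul_comm (ke u _)]
    rw [ke_cov_le hv hu h, abs_of_nonneg (by linarith)]

/-- the limiting covariance kernel in unit coordinates -/
noncomputable def Rk (u v : ℝ) : ℝ := b2 |u - v| / 2 - 3 * (b2 u * b2 v)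

lemma Rk_inner {u : ℝ} (hu : u ∈ Icc (0:ℝ) 1) :
    ∫ v in (0:ℝ)..1, Rk u v ^ 2 = 1/720 + b2 u * (u^4 - 2*u^3+u^2-1/30) / 2 + b2 u ^ 2 / 20 := by
  have e1 : ∀ v, v < u → Rk u v ^ 2 = (b2 (u - v) / 2 - 3 * (b2 u * b2 v))^2 := by
    intro v hv; unfold Rk; rw [abs_of_pos (by linarith)]
  have e2 : ∀ v, u < v → Rk u v ^ 2 = (b2 (v - u) / 2 - 3 * (b2 u * b2 v))^2 := by
    intro v hv; unfold Rk; rw [abs_sub_comm, abs_of_pos (by linarith)]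
  rw [split_int hu (by unfold b2; fun_prop) (by unfold b2; fun_prop) e1 e2]
  obtain ⟨r, hr⟩ : ∃ r, r = 3 * b2 u := ⟨_, rfl⟩
  rw [poly_eq (((u^2-u+1/6)/2 - r/6)^2) (2*((u^2-u+1/6)/2 - r/6)*((1-2*u)/2+r))
     (((1-2*u)/2+r)^2 + 2*((u^2-u+1/6)/2 - r/6)*(1/2-r)) (2*((1-2*u)/2+r)*(1/2-r)) ((1/2-r)^2) 0 0 _ _
     (by intro t; rw [← mul_assoc, ← hr]; unfold b2; ring),
    poly_eq (((u^2+u+1/6)/2 - r/6)^2) (2*((u^2+u+1/6)/2 - r/6)*((-1-2*u)/2+r))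
     (((-1-2*u)/2+r)^2 + 2*((u^2+u+1/6)/2 - r/6)*(1/2-r)) (2*((-1-2*u)/2+r)*(1/2-r)) ((1/2-r)^2) 0 0 _ _
     (by intro t; rw [← mul_assoc, ← hr]; unfold b2; ring), hr]
  unfold b2
  ring

lemma Rk_total : ∫ u in (0:ℝ)..1, ∫ v in (0:ℝ)..1, Rk u v ^ 2 = 11/12600 := by
  have : ∫ u in (0:ℝ)..1, ∫ v in (0:ℝ)..1, Rk u v ^ 2 =
      ∫ u in (0:ℝ)..1, (1/720 + b2 u * (u^4 - 2*u^3+u^2-1/30) / 2 + b2 u ^ 2 / 20) := by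
    refine intervalIntegral.integral_congr fun u hu => ?_
    rw [uIcc_of_le zero_le_one] at hu
    exact Rk_inner hu
  rw [this, poly_eq (1/720 - 1/360 + 1/720) (1/60 - 1/60) (1/12 - 1/60 + (1+1/3)/20) (-1/6-1/2 - 2/20) (1/12+1+1/2+1/20) (-1-1/2) (1/2) 0 1
    (by intro t; unfold b2; ring)]
  norm_num

end DiceAux

namespace DiceAux

lemma U_unit {c : ℝ} (hc : 0 < c) (f : ℝ → ℝ) : ∫ x, f x ∂(U c) = ∫ u in (0:ℝ)..1, f (2*c*u - c) := by
  rw [U_int' hc, intervalIntegral.integral_comp_mul_sub f (by positivity : 2*c ≠ 0), integral_Icc_eq_integral_Ioc,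
      ← intervalIntegral.integral_of_le (by linarith), smul_eq_mul]
  congr 2 <;> ring

noncomputable def ee (c x : ℝ) : ℝ := (x + c) / (2*c)

lemma ee_mem {c x : ℝ} (hc : 0 < c) (hx : x ∈ Icc (-c) c) : ee c x ∈ Icc (0:ℝ) 1 := by
  unfold ee
  constructor
  · exact div_nonneg (by linarith [hx.1]) (by positivity)
  · rw [div_le_one (by positivity)]; linarith [hx.2]

lemma ee_unit {c : ℝ} (hc : 0 < c) (u : ℝ) : ee c (2*c*u - c) = u := by
  unfold ee; field_simp; ring

lemma unit_mem {c u : ℝ} (hc : 0 < c) (hu : u ∈ Icc (0:ℝ) 1) : 2*c*u - c ∈ Icc (-c) c := by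
  constructor <;> nlinarith [hu.1, hu.2]

noncomputable def kb (c x a : ℝ) : ℝ := q c x * (q c a * ke (ee c x) (ee c a))

lemma kb_mem {c x a : ℝ} (hx : x ∈ Icc (-c) c) (ha : a ∈ Icc (-c) c) : kb c x a = ke (ee c x) (ee c a) := by
  unfold kb; rw [q_mem hx, q_mem ha]; ring

lemma kb_bound {c : ℝ} (hc : 0 < c) (x a : ℝ) : |kb c x a| ≤ 1 := by
  by_cases hx : x ∈ Icc (-c) c
  · by_cases ha : a ∈ Icc (-c) c
    · rw [kb_mem hx ha]
      have h1 := ee_mem hc hx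
      have h2 := ee_mem hc ha
      rw [abs_le]
      rcases le_or_gt (ee c a) (ee c x) with h | h
      · rw [ke_le h]; constructor <;> linarith [h1.1, h1.2, h2.1, h2.2]
      · rw [ke_gt h]; constructor <;> linarith [h1.1, h1.2, h2.1, h2.2]
    · unfold kb; rw [q_not_mem ha]; simp
  · unfold kb; rw [q_not_mem hx]; simp

lemma kb_meas2 (c : ℝ) : Measurable (fun p : ℝ × ℝ => kb c p.1 p.2) := by
  unfold kb ke ee
  have hq := (q_good c).meas
  refine (hq.comp measurable_fst).mul ((hq.comp measurable_snd).mul ?_)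
  refine Measurable.sub_const (Measurable.add ?_ (by fun_prop)) _
  exact Measurable.ite (measurableSet_le (by fun_prop) (by fun_prop)) measurable_const measurable_const

lemma kb_meas (c x : ℝ) : Measurable (kb c x) := (kb_meas2 c).comp (by fun_prop : Measurable fun a : ℝ => (x, a))

lemma unit_congr {f g : ℝ → ℝ} (h : ∀ u ∈ Icc (0:ℝ) 1, f u = g u) : ∫ u in (0:ℝ)..1, f u = ∫ u in (0:ℝ)..1, g u := by
  refine intervalIntegral.integral_congr fun u hu => ?_
  rw [uIcc_of_le zero_le_one] at hu
  exact h u hu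

lemma kb_int {c x : ℝ} (hc : 0 < c) (hx : x ∈ Icc (-c) c) : ∫ a, kb c x a ∂(U c) = 0 := by
  rw [U_unit hc]
  refine Eq.trans ?_ (ke_int_right (ee_mem hc hx))
  refine unit_congr fun u hu => ?_
  rw [kb_mem hx (unit_mem hc hu), ee_unit hc]

lemma kb_int_left {c a : ℝ} (hc : 0 < c) (ha : a ∈ Icc (-c) c) : ∫ x, kb c x a ∂(U c) = 0 := by
  rw [U_unit hc]
  refine Eq.trans ?_ (ke_int_left (ee_mem hc ha))
  refine unit_congr fun u hu => ?_
  rw [kb_mem (unit_mem hc hu) ha, ee_unit hc]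

lemma kb_mom {c x : ℝ} (hc : 0 < c) (hx : x ∈ Icc (-c) c) : ∫ a, a * kb c x a ∂(U c) = c * b2 (ee c x) := by
  rw [U_unit hc, ← ke_mom (ee_mem hc hx), ← intervalIntegral.integral_const_mul]
  refine unit_congr fun u hu => ?_
  rw [kb_mem hx (unit_mem hc hu), ee_unit hc]
  ring

lemma kb_cov {c x y : ℝ} (hc : 0 < c) (hx : x ∈ Icc (-c) c) (hy : y ∈ Icc (-c) c) :
    ∫ a, kb c x a * kb c y a ∂(U c) = b2 |ee c x - ee c y| / 2 := by
  rw [U_unit hc, ← ke_cov (ee_mem hc hx) (ee_mem hc hy)]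
  refine unit_congr fun u hu => ?_
  rw [kb_mem hx (unit_mem hc hu), kb_mem hy (unit_mem hc hu), ee_unit hc]

lemma R_total {c : ℝ} (hc : 0 < c) : ∫ x, ∫ y, Rk (ee c x) (ee c y) ^ 2 ∂(U c) ∂(U c) = 11/12600 := by
  rw [← Rk_total]
  simp_rw [U_unit hc, ee_unit hc]

lemma b2_bound {u : ℝ} (hu : u ∈ Icc (0:ℝ) 1) : |b2 u| ≤ 1 := by
  unfold b2
  rw [abs_le]; constructor <;> nlinarith [hu.1, hu.2]

lemma Rk_bound {u v : ℝ} (hu : u ∈ Icc (0:ℝ) 1) (hv : v ∈ Icc (0:ℝ) 1) : |Rk u v| ≤ 4 := by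
  have h1 := b2_bound hu
  have h2 := b2_bound hv
  have h3 : |b2 (|u - v|)| ≤ 1 := b2_bound ⟨abs_nonneg _, abs_le.2 ⟨by linarith [hu.1, hv.2], by linarith [hu.2, hv.1]⟩⟩
  have h4 : |b2 u * b2 v| ≤ 1 := by
    rw [abs_mul]; exact mul_le_one₀ h1 (abs_nonneg _) h2
  unfold Rk
  rw [abs_le] at *
  constructor <;> linarith [h3.1, h3.2, h4.1, h4.2]

/-- centred counting function -/
noncomputable def GG (c : ℝ) {n : ℕ} (x : ℝ) (A : Fin n → ℝ) : ℝ := ∑ i, kb c x (A i)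

lemma GG_bound {c : ℝ} (hc : 0 < c) {n : ℕ} (x : ℝ) (A : Fin n → ℝ) : |GG c x A| ≤ n := by
  unfold GG
  refine (Finset.abs_sum_le_sum_abs _ _).trans ?_
  refine (Finset.sum_le_sum fun i _ => kb_bound hc x (A i)).trans ?_
  simp

lemma GG_meas (c : ℝ) (n : ℕ) : Measurable (fun p : ℝ × (Fin n → ℝ) => GG c p.1 p.2) := by
  unfold GG
  refine Finset.measurable_fun_sum _ fun i _ => ?_
  exact (kb_meas2 c).comp (by fun_prop : Measurable fun p : ℝ × (Fin n → ℝ) => (p.1, p.2 i))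

lemma Rn_bound : ∃ C > (0:ℝ), ∃ N : ℕ, ∀ n : ℕ, N ≤ n → 1 ≤ n ∧
    IsProbabilityMeasure (diceMeasure n (-Real.sqrt 3) (Real.sqrt 3) 0) ∧
    (∀ᵐ A ∂(diceMeasure n (-Real.sqrt 3) (Real.sqrt 3) 0), ∀ i, A i ∈ Icc (-Real.sqrt 3) (Real.sqrt 3)) ∧
    ∀ x ∈ Icc (-Real.sqrt 3) (Real.sqrt 3), ∀ y ∈ Icc (-Real.sqrt 3) (Real.sqrt 3),
      |∫ A, GG (Real.sqrt 3) x A * GG (Real.sqrt 3) y A ∂(diceMeasure n (-Real.sqrt 3) (Real.sqrt 3) 0)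
        - n * Rk (ee (Real.sqrt 3) x) (ee (Real.sqrt 3) y)| ≤ C := by
  obtain ⟨C, hC, N, hN⟩ := J_ratio
  have hc : 0 < Real.sqrt 3 := by positivity
  have hcs : Real.sqrt 3 ^ 2 = 3 := Real.sq_sqrt (by norm_num)
  set c := Real.sqrt 3 with hcdef
  refine ⟨3 * C + 3, by positivity, max N 4, fun n hn => ?_⟩
  obtain ⟨hJ, h1, α, β, h2, h3⟩ := hN n (le_of_max_le_left hn)
  have hn4 : 4 ≤ n := le_of_max_le_right hn
  obtain ⟨m, rfl⟩ : ∃ m, n = m + 3 := ⟨n - 3, by omega⟩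
  have hm : 1 ≤ m := by omega
  have hp : IsProbabilityMeasure (diceMeasure (m+3) (-c) c 0) := dice_prob hc (by omega) hJ
  refine ⟨by omega, hp, dice_ae _ _, fun x hx y hy => ?_⟩
  set ν := diceMeasure (m+3) (-c) c 0 with hν
  set n : ℝ := ((m+3 : ℕ) : ℝ) with hnr
  have hn0 : 1 ≤ n := by rw [hnr]; exact_mod_cast (by omega : 1 ≤ m + 3)
  have hi : ∀ i j : Fin (m+3), Integrable (fun A : Fin (m+3) → ℝ => kb c x (A i) * kb c y (A j)) ν := by
    intro i j
    refine Integrable.of_bound (C := 1) ?_ (Filter.Eventually.of_forall fun A => ?_)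
    · exact (((kb_meas c x).comp (measurable_pi_apply i)).mul ((kb_meas c y).comp (measurable_pi_apply j))).aestronglyMeasurable
    · rw [norm_mul]; exact mul_le_one₀ (kb_bound hc _ _) (norm_nonneg _) (kb_bound hc _ _)
  have hexp : ∫ A, GG c x A * GG c y A ∂ν = ∑ i, ∑ j, ∫ A, kb c x (A i) * kb c y (A j) ∂ν := by
    unfold GG
    simp_rw [Finset.sum_mul_sum]
    rw [integral_finsetSum _ fun i _ => integrable_finsetSum _ fun j _ => hi i j]
    refine Finset.sum_congr rfl fun i _ => ?_
    rw [integral_finsetSum _ fun j _ => hi i j]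
  set bb := b2 (ee c x) * b2 (ee c y) with hbb
  set K := b2 |ee c x - ee c y| / 2 with hK
  have hdiag : ∀ i, |∫ A, kb c x (A i) * kb c y (A i) ∂ν - K| ≤ C / n := by
    intro i
    have := law1_approx (m := m+1) (B := 1) (f := fun a => kb c x a * kb c y a) hc (by omega) ((kb_meas c x).mul (kb_meas c y)) zero_le_one
      (fun a _ => by rw [abs_mul]; exact mul_le_one₀ (kb_bound hc _ _) (abs_nonneg _) (kb_bound hc _ _)) hJ h1 i
    rw [kb_cov hc hx hy, one_mul] at this
    exact this
  have hoff : ∀ i j, j ≠ i → |∫ A, kb c x (A i) * kb c y (A j) ∂ν + 2 * β * bb| ≤ C / n^2 := by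
    intro i j hij
    have := law2_approx (m := m) (B := 1) (B' := 1) hc hm (kb_meas c x) zero_le_one (fun a _ => kb_bound hc _ _)
      (kb_meas c y) zero_le_one (fun a _ => kb_bound hc _ _) hJ h2 (kb_int hc hx) (kb_int hc hy) i j hij
    rw [kb_mom hc hx, kb_mom hc hy, one_mul, one_mul] at this
    have e : 2 * β / c^2 * (c * b2 (ee c x) * (c * b2 (ee c y))) = 2 * β * bb := by
      rw [hbb]; field_simp
    rw [e] at this
    exact this
  have hsum : |∑ i : Fin (m+3), ∑ j : Fin (m+3), (∫ A, kb c x (A i) * kb c y (A j) ∂ν - if j = i then K else - (2 * β * bb))| ≤ 2 * C := by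
    have hterm : ∀ i j : Fin (m+3), |∫ A, kb c x (A i) * kb c y (A j) ∂ν - if j = i then K else - (2 * β * bb)| ≤ (if j = i then C / n else 0) + C / n^2 := by
      intro i j
      by_cases h : j = i
      · rw [if_pos h, if_pos h, h]
        have : 0 ≤ C / n^2 := by positivity
        linarith [hdiag i]
      · rw [if_neg h, if_neg h, zero_add, sub_neg_eq_add]; exact hoff i j h
    calc _ ≤ ∑ i : Fin (m+3), ∑ j : Fin (m+3), |∫ A, kb c x (A i) * kb c y (A j) ∂ν - if j = i then K else - (2 * β * bb)| :=
          (Finset.abs_sum_le_sum_abs _ _).trans (Finset.sum_le_sum fun i _ => Finset.abs_sum_le_sum_abs _ _)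
      _ ≤ ∑ i : Fin (m+3), ∑ j : Fin (m+3), ((if j = i then C / n else 0) + C / n^2) :=
          Finset.sum_le_sum fun i _ => Finset.sum_le_sum fun j _ => hterm i j
      _ = n * (C / n + n * (C / n^2)) := by
          simp only [Finset.sum_add_distrib, Finset.sum_ite_eq', Finset.mem_univ, if_true, Finset.sum_const, Finset.card_univ, Fintype.card_fin, nsmul_eq_mul]
          rw [← hnr]; ring
      _ = 2 * C := by field_simp; ring
  have hmain : ∑ i : Fin (m+3), ∑ j : Fin (m+3), (if j = i then K else - (2 * β * bb)) = n * K - n * (n - 1) * (2 * β * bb) := by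
    have : ∀ i j : Fin (m+3), (if j = i then K else - (2 * β * bb)) = (if j = i then (K + 2 * β * bb) else 0) + (-(2 * β * bb)) := by
      intro i j; split_ifs <;> ring
    simp_rw [this]
    simp only [Finset.sum_add_distrib, Finset.sum_ite_eq', Finset.mem_univ, if_true, Finset.sum_const, Finset.card_univ, Fintype.card_fin, nsmul_eq_mul]
    rw [← hnr]; ring
  have hbb1 : |bb| ≤ 1 := by
    rw [hbb, abs_mul]; exact mul_le_one₀ (b2_bound (ee_mem hc hx)) (abs_nonneg _) (b2_bound (ee_mem hc hy))
  have hlast : |(n * K - n * (n - 1) * (2 * β * bb)) - n * (K - 3 * bb)| ≤ C + 3 := by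
    have e : (n * K - n * (n - 1) * (2 * β * bb)) - n * (K - 3 * bb) = bb * (3 - (n-1) * (2 * β * n - 3)) := by ring
    rw [e, abs_mul]
    have h5 : |3 - (n-1) * (2 * β * n - 3)| ≤ C + 3 := by
      have h6 : |(n-1) * (2 * β * n - 3)| ≤ C := by
        rw [abs_mul, abs_of_nonneg (by linarith : 0 ≤ n - 1)]
        calc (n-1) * |2 * β * n - 3| ≤ n * (C / n) := by
              refine mul_le_mul (by linarith) h3 (abs_nonneg _) (by linarith)
          _ = C := by field_simp
      refine (abs_sub _ _).trans ?_
      rw [abs_of_pos (by norm_num : (0:ℝ) < 3)]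
      linarith
    calc |bb| * _ ≤ 1 * (C + 3) := mul_le_mul hbb1 h5 (abs_nonneg _) zero_le_one
      _ = C + 3 := one_mul _
  simp only [Finset.sum_sub_distrib] at hsum
  rw [hmain, ← hexp] at hsum
  have hR : Rk (ee c x) (ee c y) = K - 3 * bb := rfl
  rw [hR]
  have := abs_add_le (∫ A, GG c x A * GG c y A ∂ν - (n * K - n * (n - 1) * (2 * β * bb))) ((n * K - n * (n - 1) * (2 * β * bb)) - n * (K - 3 * bb))
  rw [sub_add_sub_cancel] at this
  linarith

end DiceAux

namespace DiceAux

lemma meanS_eq (f : ℝ → ℝ) : meanS f = ∫ x, f x ∂(U (Real.sqrt 3)) :=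
  (U_int' (by positivity) f).symm

lemma gDie_eq {n : ℕ} (A : Fin n → ℝ) (hA : ∀ i, A i ∈ Icc (-Real.sqrt 3) (Real.sqrt 3)) {x : ℝ}
    (hx : x ∈ Icc (-Real.sqrt 3) (Real.sqrt 3)) :
    gDie n A x = GG (Real.sqrt 3) x A - (∑ i, A i) / (2 * Real.sqrt 3) := by
  have hc : 0 < Real.sqrt 3 := by positivity
  unfold gDie GG
  set c := Real.sqrt 3 with hcd
  have h1 : ∀ i, kb c x (A i) = (if A i ≤ x then 1 else 0) + A i / (2*c) - (x + c) / (2*c) := by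
    intro i
    rw [kb_mem hx (hA i)]
    unfold ke
    have : ee c (A i) ≤ ee c x ↔ A i ≤ x := by
      unfold ee
      rw [div_le_div_iff_of_pos_right (by positivity)]
      constructor <;> intro h <;> linarith
    simp only [this]
    unfold ee
    field_simp
    ring
  simp_rw [h1]
  rw [Finset.sum_sub_distrib, Finset.sum_add_distrib, Finset.sum_boole, ← Finset.sum_div]
  simp only [Finset.sum_const, Finset.card_univ, Fintype.card_fin, nsmul_eq_mul]
  ring

lemma GG_meas_left (c : ℝ) {n : ℕ} (A : Fin n → ℝ) : Measurable (fun x => GG c x A) :=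
  (GG_meas c n).comp (by fun_prop : Measurable fun x : ℝ => (x, A))

lemma cv_eq {n : ℕ} (A B : Fin n → ℝ) (hA : ∀ i, A i ∈ Icc (-Real.sqrt 3) (Real.sqrt 3))
    (hB : ∀ i, B i ∈ Icc (-Real.sqrt 3) (Real.sqrt 3)) :
    cvDie₂ n A B = ∫ x, GG (Real.sqrt 3) x A * GG (Real.sqrt 3) x B ∂(U (Real.sqrt 3)) := by
  have hc : 0 < Real.sqrt 3 := by positivity
  have hU := U_prob hc
  unfold cvDie₂
  simp only [meanS_eq]
  set c := Real.sqrt 3 with hcd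
  obtain ⟨sA, hsA⟩ : ∃ s, s = (∑ i, A i) / (2 * c) := ⟨_, rfl⟩
  obtain ⟨sB, hsB⟩ : ∃ s, s = (∑ i, B i) / (2 * c) := ⟨_, rfl⟩
  have iG : ∀ D : Fin n → ℝ, Integrable (fun x => GG c x D) (U c) := fun D =>
    U_integrable hc (GG_meas_left c D) (fun x _ => GG_bound hc x D)
  have G0 : ∀ D : Fin n → ℝ, (∀ i, D i ∈ Icc (-c) c) → ∫ x, GG c x D ∂(U c) = 0 := by
    intro D hD
    unfold GG
    rw [integral_finsetSum]
    · exact Finset.sum_eq_zero fun i _ => kb_int_left hc (hD i)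
    · intro i _
      exact U_integrable hc ((kb_meas2 c).comp (by fun_prop : Measurable fun x : ℝ => (x, D i))) (fun x _ => kb_bound hc x _)
  have iAB : Integrable (fun x => GG c x A * GG c x B) (U c) :=
    U_integrable (B := n * n) hc ((GG_meas_left c A).mul (GG_meas_left c B)) (fun x _ => by
      rw [abs_mul]; exact mul_le_mul (GG_bound hc x A) (GG_bound hc x B) (abs_nonneg _) (by positivity))
  have eA : ∫ x, gDie n A x ∂(U c) = -sA := by
    have : ∫ x, gDie n A x ∂(U c) = ∫ x, (GG c x A - sA) ∂(U c) := by
      refine integral_congr_ae ?_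
      filter_upwards [U_ae c] with x hx
      rw [gDie_eq A hA hx, hsA]
    rw [this, integral_sub (iG A) (integrable_const _), G0 A hA]; simp
  have eB : ∫ x, gDie n B x ∂(U c) = -sB := by
    have : ∫ x, gDie n B x ∂(U c) = ∫ x, (GG c x B - sB) ∂(U c) := by
      refine integral_congr_ae ?_
      filter_upwards [U_ae c] with x hx
      rw [gDie_eq B hB hx, hsB]
    rw [this, integral_sub (iG B) (integrable_const _), G0 B hB]; simp
  have eAB : ∫ x, gDie n A x * gDie n B x ∂(U c) = ∫ x, ((GG c x A * GG c x B - sB * GG c x A) - (sA * GG c x B - sA * sB)) ∂(U c) := by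
    refine integral_congr_ae ?_
    filter_upwards [U_ae c] with x hx
    rw [gDie_eq A hA hx, gDie_eq B hB hx, ← hcd, ← hsA, ← hsB]
    ring
  have i1 : Integrable (fun x => GG c x A * GG c x B - sB * GG c x A) (U c) := iAB.sub ((iG A).const_mul _)
  have i2 : Integrable (fun x => sA * GG c x B - sA * sB) (U c) := ((iG B).const_mul _).sub (integrable_const _)
  rw [eA, eB, eAB, integral_sub i1 i2, integral_sub iAB ((iG A).const_mul _),
    integral_sub ((iG B).const_mul _) (integrable_const _), integral_const_mul, integral_const_mul, G0 A hA, G0 B hB]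
  simp

lemma second_moment_eq {n : ℕ} (ν : Measure (Fin n → ℝ)) [IsProbabilityMeasure ν]
    (hν : ∀ᵐ A ∂ν, ∀ i, A i ∈ Icc (-Real.sqrt 3) (Real.sqrt 3)) :
    Integrable (fun z : ℝ × ℝ => (∫ A, GG (Real.sqrt 3) z.1 A * GG (Real.sqrt 3) z.2 A ∂ν)^2)
      ((U (Real.sqrt 3)).prod (U (Real.sqrt 3))) ∧
    ∫ p, cvDie₂ n p.1 p.2 ^ 2 ∂(ν.prod ν) =
    ∫ z, (∫ A, GG (Real.sqrt 3) z.1 A * GG (Real.sqrt 3) z.2 A ∂ν)^2 ∂((U (Real.sqrt 3)).prod (U (Real.sqrt 3))) := by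
  have hc : 0 < Real.sqrt 3 := by positivity
  have hU := U_prob hc
  set c := Real.sqrt 3 with hcd
  set H : ((Fin n → ℝ) × (Fin n → ℝ)) → ℝ × ℝ → ℝ := fun p z =>
    (GG c z.1 p.1 * GG c z.1 p.2) * (GG c z.2 p.1 * GG c z.2 p.2) with hH
  have hHm : Measurable (Function.uncurry H) := by
    have g := GG_meas c n
    refine Measurable.mul (Measurable.mul ?_ ?_) (Measurable.mul ?_ ?_)
    · exact g.comp (by fun_prop : Measurable fun r : ((Fin n → ℝ) × (Fin n → ℝ)) × ℝ × ℝ => (r.2.1, r.1.1))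
    · exact g.comp (by fun_prop : Measurable fun r : ((Fin n → ℝ) × (Fin n → ℝ)) × ℝ × ℝ => (r.2.1, r.1.2))
    · exact g.comp (by fun_prop : Measurable fun r : ((Fin n → ℝ) × (Fin n → ℝ)) × ℝ × ℝ => (r.2.2, r.1.1))
    · exact g.comp (by fun_prop : Measurable fun r : ((Fin n → ℝ) × (Fin n → ℝ)) × ℝ × ℝ => (r.2.2, r.1.2))
  have hb2 : ∀ x (A : Fin n → ℝ) y (B : Fin n → ℝ), |GG c x A * GG c y B| ≤ n * n := by
    intro x A y B
    rw [abs_mul]; exact mul_le_mul (GG_bound hc x A) (GG_bound hc y B) (abs_nonneg _) (by positivity)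
  have hHi : Integrable (Function.uncurry H) ((ν.prod ν).prod ((U c).prod (U c))) := by
    refine Integrable.of_bound (C := (n*n)*(n*n)) hHm.aestronglyMeasurable (Filter.Eventually.of_forall fun r => ?_)
    simp only [Function.uncurry, hH]
    rw [norm_mul]
    exact mul_le_mul (hb2 _ _ _ _) (hb2 _ _ _ _) (norm_nonneg _) (by positivity)
  have hz : ∀ z : ℝ × ℝ, ∫ p, H p z ∂(ν.prod ν) = (∫ A, GG c z.1 A * GG c z.2 A ∂ν)^2 := by
    intro z
    rw [sq, ← integral_prod_mul]
    congr 1; ext p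
    simp only [hH]; ring
  have hinteg := hHi.integral_prod_right
  simp only [Function.uncurry_apply_pair, hz] at hinteg
  refine ⟨hinteg, ?_⟩
  simp_rw [← hz]
  rw [← integral_integral_swap hHi]
  have aeprod : ∀ᵐ p ∂(ν.prod ν), (∀ i, p.1 i ∈ Icc (-c) c) ∧ (∀ i, p.2 i ∈ Icc (-c) c) :=
    (Measure.quasiMeasurePreserving_fst.ae hν).and (Measure.quasiMeasurePreserving_snd.ae hν)
  refine integral_congr_ae ?_
  filter_upwards [aeprod] with p hp
  rw [cv_eq p.1 p.2 hp.1 hp.2, sq, ← integral_prod_mul]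

lemma Rk_cont (c : ℝ) : Continuous (fun z : ℝ × ℝ => Rk (ee c z.1) (ee c z.2)) := by
  unfold Rk b2 ee
  fun_prop

lemma final_bound : ∃ C > (0:ℝ), ∃ N : ℕ, ∀ n : ℕ, N ≤ n → 1 ≤ n ∧
      |(∫ p, cvDie₂ n p.1 p.2 ^ 2
          ∂((diceMeasure n (-Real.sqrt 3) (Real.sqrt 3) 0).prod
              (diceMeasure n (-Real.sqrt 3) (Real.sqrt 3) 0))) -
          11 / 12600 * (n : ℝ) ^ 2| ≤ C * n := by
  obtain ⟨C, hC, N, hN⟩ := Rn_bound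
  refine ⟨C * (C + 8), by positivity, N, fun n hn => ?_⟩
  obtain ⟨hn1, hp, hae, hR⟩ := hN n hn
  refine ⟨hn1, ?_⟩
  obtain ⟨hi, he⟩ := second_moment_eq _ hae
  rw [he]
  have hc : 0 < Real.sqrt 3 := by positivity
  have hU := U_prob hc
  set c := Real.sqrt 3 with hcd
  set ν := diceMeasure n (-c) c 0 with hν
  have aeprod : ∀ᵐ p ∂((U c).prod (U c)), p.1 ∈ Icc (-c) c ∧ p.2 ∈ Icc (-c) c :=
    (Measure.quasiMeasurePreserving_fst.ae (U_ae c)).and (Measure.quasiMeasurePreserving_snd.ae (U_ae c))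
  have iR : Integrable (fun z : ℝ × ℝ => Rk (ee c z.1) (ee c z.2) ^ 2) ((U c).prod (U c)) := by
    refine Integrable.of_bound (C := 16) ((Rk_cont c).pow 2).aestronglyMeasurable ?_
    filter_upwards [aeprod] with z hz
    rw [norm_pow, Real.norm_eq_abs]
    have := Rk_bound (ee_mem hc hz.1) (ee_mem hc hz.2)
    nlinarith [abs_nonneg (Rk (ee c z.1) (ee c z.2))]
  have hT : 11 / 12600 * (n:ℝ)^2 = ∫ z : ℝ × ℝ, (n:ℝ)^2 * Rk (ee c z.1) (ee c z.2) ^ 2 ∂((U c).prod (U c)) := by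
    rw [integral_const_mul, integral_prod _ iR, R_total hc]; ring
  rw [hT, ← integral_sub hi (iR.const_mul _)]
  have hn1' : (1:ℝ) ≤ n := by exact_mod_cast hn1
  have hb : ∀ᵐ z ∂((U c).prod (U c)), ‖(∫ A, GG c z.1 A * GG c z.2 A ∂ν)^2 - (n:ℝ)^2 * Rk (ee c z.1) (ee c z.2) ^ 2‖ ≤ C * (C + 8) * n := by
    filter_upwards [aeprod] with z hz
    have h1 := hR _ hz.1 _ hz.2
    have h2 := Rk_bound (ee_mem hc hz.1) (ee_mem hc hz.2)
    generalize (∫ A, GG c z.1 A * GG c z.2 A ∂ν) = I at h1 ⊢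
    generalize Rk (ee c z.1) (ee c z.2) = r at h1 h2 ⊢
    have e : I^2 - (n:ℝ)^2 * r^2 = (I - n * r) * ((I - n * r) + 2 * (n * r)) := by ring
    rw [e, Real.norm_eq_abs, abs_mul]
    have h3 : |n * r| ≤ n * 4 := by
      rw [abs_mul, abs_of_nonneg (by linarith : (0:ℝ) ≤ n)]; gcongr
    have h4 : |(I - n * r) + 2 * (n * r)| ≤ (C + 8) * n := by
      refine (abs_add_le _ _).trans ?_
      rw [abs_mul, abs_two]
      nlinarith
    calc _ ≤ C * ((C+8) * n) := mul_le_mul h1 h4 (abs_nonneg _) hC.le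
      _ = _ := by ring
  have := norm_integral_le_of_norm_le_const hb
  simpa using this

end DiceAux

theorem cvAB_second_moment :
    ∃ C > (0 : ℝ), ∃ N : ℕ, ∀ n : ℕ, N ≤ n →
      |(∫ p, cvDie₂ n p.1 p.2 ^ 2
          ∂((diceMeasure n (-Real.sqrt 3) (Real.sqrt 3) 0).prod
              (diceMeasure n (-Real.sqrt 3) (Real.sqrt 3) 0))) -
          11 / 12600 * (n : ℝ) ^ 2| ≤ C * n ∧
      0.025 * (n : ℝ) <
        Real.sqrt
          (∫ p, cvDie₂ n p.1 p.2 ^ 2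
            ∂((diceMeasure n (-Real.sqrt 3) (Real.sqrt 3) 0).prod
                (diceMeasure n (-Real.sqrt 3) (Real.sqrt 3) 0))) := by
  obtain ⟨C, hC, N, hN⟩ := DiceAux.final_bound
  obtain ⟨M, hM⟩ := exists_nat_gt (C * 10000)
  refine ⟨C, hC, max N M, fun n hn => ?_⟩
  obtain ⟨hn1, hb⟩ := hN n (le_of_max_le_left hn)
  refine ⟨hb, ?_⟩
  have hnM : (M:ℝ) ≤ n := by exact_mod_cast le_of_max_le_right hn
  have hn1' : (1:ℝ) ≤ n := by exact_mod_cast hn1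
  refine Real.lt_sqrt_of_sq_lt ?_
  have h1 := (abs_le.1 hb).1
  have h2 : C * n ≤ (n:ℝ)^2 / 10000 := by nlinarith
  nlinarith
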